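/- arXiv:2204.09642 — 4 statements merged into one kernel-verified Lean document; each statement's English description precedes it below -/
import Mathlib

section
/- Let E be a Polish space and W ∈ L¹₊[0,1]² a nonnegative kernel. Then for almost every u ∈ [0,1], the map P_Unif([0,1] × E) ∋ μ ↦ Wμ(u) ∈ M₊(E) is continuous, where both spaces carry the topology of weak convergence. -/
open MeasureTheory ProbabilityTheory Filter Set
open scoped NNReal ENNReal Topology

noncomputable section

/-- The uniform (Lebesgue) measure on `[0,1]`, as a measure on `ℝ`. -/
def unif01 : Measure ℝ := volume.restrict (Set.Icc 0 1)

/-- If the first marginal of `μ` is held fixed equal to `ν`, then `μ ↦ ∫ f(v) φ(x) μ(dv,dx)` is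
weakly continuous for every `ν`-integrable `f` and every bounded continuous `φ`. -/
theorem continuous_integral_mul_of_map_fst_eq
    {X E : Type*} [TopologicalSpace X] [NormalSpace X] [SecondCountableTopology X]
    [MeasurableSpace X] [BorelSpace X] [TopologicalSpace E] [MeasurableSpace E] [BorelSpace E]
    {ν : Measure X} [ν.WeaklyRegular] {f : X → ℝ} (hf : Integrable f ν)
    (φ : BoundedContinuousFunction E ℝ) :
    Continuous (fun μ : {μ : ProbabilityMeasure (X × E) //
        (μ : Measure (X × E)).map Prod.fst = ν} =>
      ∫ p, f p.1 * φ p.2 ∂(μ.1 : Measure (X × E))) := by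
  refine continuous_of_uniform_approx_of_continuous fun V hV => ?_
  obtain ⟨ε, hε, hεV⟩ := Metric.mem_uniformity_dist.1 hV
  have hC : 0 < ‖φ‖ + 1 := by positivity
  obtain ⟨g, hg, hgint⟩ := hf.exists_boundedContinuous_integral_sub_le
    (ε := ε / 2 / (‖φ‖ + 1)) (by positivity)
  refine ⟨fun μ => ∫ p, g p.1 * φ p.2 ∂(μ.1 : Measure (X × E)), ?_, fun μ => hεV ?_⟩
  · let h : BoundedContinuousFunction (X × E) ℝ :=
      g.compContinuous ⟨Prod.fst, continuous_fst⟩ * φ.compContinuous ⟨Prod.snd, continuous_snd⟩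
    exact (ProbabilityMeasure.continuous_integral_boundedContinuousFunction h).comp
      continuous_subtype_val
  · obtain ⟨μ, hμ⟩ := μ
    have hmp : MeasurePreserving Prod.fst (μ : Measure (X × E)) ν := ⟨measurable_fst, hμ⟩
    have hmul : ∀ {k : X → ℝ}, Integrable k ν →
        Integrable (fun p : X × E => k p.1 * φ p.2) (μ : Measure (X × E)) := fun hk =>
      (hmp.integrable_comp_of_integrable hk).mul_bdd
        (φ.continuous.measurable.comp measurable_snd).aestronglyMeasurable
        (ae_of_all _ fun p => φ.norm_coe_le_norm p.2)
    have hd : Integrable (fun x => ‖f x - g x‖) ν := (hf.sub hgint).norm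
    have hmap : ∫ p, ‖f p.1 - g p.1‖ ∂(μ : Measure (X × E)) = ∫ x, ‖f x - g x‖ ∂ν := by
      rw [← hμ, integral_map measurable_fst.aemeasurable (by rw [hμ]; exact hd.1)]
    rw [dist_eq_norm, ← integral_sub (hmul hf) (hmul hgint)]
    calc ‖∫ p, (f p.1 * φ p.2 - g p.1 * φ p.2) ∂(μ : Measure (X × E))‖
        ≤ ∫ p, ‖f p.1 - g p.1‖ * (‖φ‖ + 1) ∂(μ : Measure (X × E)) := by
          refine norm_integral_le_of_norm_le
            ((hmp.integrable_comp_of_integrable hd).mul_const _) (ae_of_all _ fun p => ?_)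
          rw [← sub_mul, norm_mul]
          gcongr
          linarith [φ.norm_coe_le_norm p.2]
      _ ≤ ε / 2 / (‖φ‖ + 1) * (‖φ‖ + 1) := by
          rw [integral_mul_const, hmap]
          gcongr
      _ < ε := by
          rw [div_mul_cancel₀ _ hC.ne']
          exact half_lt_self hε

/-- For a nonnegative kernel `W ∈ L¹₊[0,1]²` and a Polish space `E`, for a.e.
`u ∈ [0,1]` the map `P_Unif([0,1] × E) ∋ μ ↦ Wμ(u) ∈ M₊(E)` is continuous for the topologies of
weak convergence.  Continuity into `M₊(E)` is expressed through the defining test integrals: for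
every bounded continuous `φ : E → ℝ`, the pairing
`μ ↦ ⟨Wμ(u), φ⟩ = ∫_{[0,1]×E} W(u,v) φ(x) μ(dv,dx)` is continuous. -/
theorem graphon_operator_continuous_in_measure
    {E : Type*} [TopologicalSpace E] [PolishSpace E] [MeasurableSpace E] [BorelSpace E]
    (W : ℝ → ℝ → ℝ)
    (hWmeas : Measurable fun p : ℝ × ℝ => W p.1 p.2)
    (hWint : Integrable (fun p : ℝ × ℝ => W p.1 p.2) (unif01.prod unif01))
    (hWnonneg : ∀ᵐ p ∂unif01.prod unif01, 0 ≤ W p.1 p.2) :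
    ∀ᵐ u ∂unif01, ∀ φ : E → ℝ, Continuous φ → (∃ C, ∀ x, |φ x| ≤ C) →
      Continuous (fun μ : {μ : ProbabilityMeasure (ℝ × E) //
          (μ : Measure (ℝ × E)).map Prod.fst = unif01} =>
        ∫ p, W u p.1 * φ p.2 ∂(μ.1 : Measure (ℝ × E))) := by
  have : IsFiniteMeasure unif01 := by unfold unif01; infer_instance
  filter_upwards [hWint.prod_right_ae] with u hu φ hφ ⟨C, hC⟩
  exact continuous_integral_mul_of_map_fst_eq hu
    (BoundedContinuousFunction.ofNormedAddCommGroup φ hφ C hC)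

end
end

section
/- Let E be a Polish space and W ∈ L¹₊[0,1]² a nonnegative kernel such that the map [0,1] ∋ u ↦ W(u,v)dv ∈ M₊([0,1]) is weakly continuous. Let μ ∈ P_Unif([0,1] × E) admit a disintegration μ(du,dx) = du μ_u(dx) such that u ↦ μ_u ∈ P(E) is weakly continuous. Then the map [0,1] ∋ u ↦ Wμ(u) ∈ M₊(E) is continuous. -/
open MeasureTheory ProbabilityTheory Filter Set
open scoped NNReal ENNReal Topology

noncomputable section

/-- Let `W ∈ L¹₊[0,1]²` be a nonnegative kernel such that
`u ↦ W(u,v)dv ∈ M₊([0,1])` is weakly continuous (tested against continuous functions), and let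
`μ ∈ P_Unif([0,1] × E)` admit a weakly continuous disintegration `u ↦ μ_u`.  Then
`u ↦ Wμ(u) ∈ M₊(E)` is continuous on `[0,1]`; continuity into `M₊(E)` is expressed through the
defining test integrals against bounded continuous `φ : E → ℝ`. -/
theorem graphon_measure_continuous_in_label
    {E : Type*} [TopologicalSpace E] [PolishSpace E] [MeasurableSpace E] [BorelSpace E]
    (W : ℝ → ℝ → ℝ)
    (hWmeas : Measurable fun p : ℝ × ℝ => W p.1 p.2)
    (hWint : Integrable (fun p : ℝ × ℝ => W p.1 p.2) (unif01.prod unif01))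
    (hWnonneg : ∀ᵐ p ∂unif01.prod unif01, 0 ≤ W p.1 p.2)
    (hWslice : ∀ u ∈ Set.Icc (0:ℝ) 1, Integrable (W u) unif01)
    (hWcont : ∀ g : ℝ → ℝ, Continuous g →
      ContinuousOn (fun u => ∫ v, W u v * g v ∂unif01) (Set.Icc (0:ℝ) 1))
    (μ : Measure (ℝ × E)) [IsProbabilityMeasure μ]
    (hμfst : μ.map Prod.fst = unif01)
    (μd : ℝ → ProbabilityMeasure E)
    (hμdmeas : Measurable fun u => (μd u : Measure E))
    (hdisint : μ = unif01.bind fun u => (μd u : Measure E).map fun x => (u, x))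
    (hμdcont : ContinuousOn μd (Set.Icc (0:ℝ) 1)) :
    ∀ φ : E → ℝ, Continuous φ → (∃ C, ∀ x, |φ x| ≤ C) →
      ContinuousOn (fun u => ∫ p, W u p.1 * φ p.2 ∂μ) (Set.Icc (0:ℝ) 1) := by
  rintro φ hφ ⟨C, hC⟩
  have hμdint : ContinuousOn (fun v => ∫ x, φ x ∂(μd v : Measure E)) (Set.Icc (0:ℝ) 1) := by
    let ψ : BoundedContinuousFunction E ℝ := BoundedContinuousFunction.ofNormedAddCommGroup φ hφ C hC
    intro v hv
    exact (ProbabilityMeasure.tendsto_iff_forall_integral_tendsto.1 (hμdcont v hv)) ψ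
  set g : ℝ → ℝ := Set.IccExtend (zero_le_one' ℝ)
    ((Set.Icc (0:ℝ) 1).domRestrict fun v => ∫ x, φ x ∂(μd v : Measure E)) with hg
  have hgcont : Continuous g := hμdint.domRestrict.Icc_extend'
  refine (hWcont g hgcont).congr fun u hu => ?_
  let κ : Kernel ℝ E := ⟨fun v => (μd v : Measure E), hμdmeas⟩
  have : IsMarkovKernel κ := ⟨fun v => inferInstanceAs (IsProbabilityMeasure (μd v : Measure E))⟩
  have : IsFiniteMeasure unif01 := by unfold unif01; infer_instance
  have hcomp : μ = unif01 ⊗ₘ κ := by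
    rw [hdisint, Measure.compProd_eq_comp_prod]
    congr 1
    ext1 v
    rw [Kernel.prod_apply, Kernel.id_apply, Measure.dirac_prod]
    rfl
  have hWu : Integrable (fun p : ℝ × E => W u p.1) μ := by
    have h := hWslice u hu
    rw [← hμfst] at h
    exact h.comp_measurable measurable_fst
  have hint : Integrable (fun p : ℝ × E => W u p.1 * φ p.2) μ :=
    hWu.mul_bdd (c := C) (hφ.measurable.comp measurable_snd).aestronglyMeasurable
      (ae_of_all _ fun p => hC p.2)
  change ∫ p, W u p.1 * φ p.2 ∂μ = ∫ v, W u v * g v ∂unif01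
  rw [hcomp] at hint ⊢
  rw [Measure.integral_compProd hint]
  refine setIntegral_congr_fun measurableSet_Icc fun v hv => ?_
  simp only [integral_const_mul, hg, Set.IccExtend_of_mem _ _ hv]
  rfl

end
end

section
/- Let W ∈ L¹₊[0,1]² be a nonnegative kernel, A a compact metric space, T > 0, d ∈ ℕ, and let f : [0,T] × ℝ^d × M₊(ℝ^d) × A → ℝ and g : ℝ^d × M₊(ℝ^d) → ℝ be bounded and continuous. Then the map (μ, P) ↦ ∫_{V × [0,1] × C^d} Γ^μ dP is jointly continuous on P_Unif([0,1] × C^d) × {P ∈ P(V × [0,1] × C^d) : the [0,1]-marginal of P is uniform}, where both factors carry the weak convergence topology. -/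
open MeasureTheory ProbabilityTheory Filter Set
open scoped NNReal ENNReal Topology

noncomputable section

/-- The measure `Wm(u)` on `E` associated with a kernel `W` and a measure `m` on `[0,1] × E`:
it integrates a function `φ` to `∫_{[0,1]×E} W(u,v) φ(x) m(dv,dx)`. -/
def Wmeas {E : Type*} [MeasurableSpace E] (W : ℝ → ℝ → ℝ) (m : Measure (ℝ × E)) (u : ℝ) :
    Measure E :=
  (m.withDensity fun p => ENNReal.ofReal (W u p.1)).map Prod.snd

open Classical in
/-- The measure `Wm(u)`, packaged as a finite measure (junk value `0` on the null set of labels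
`u` where it is not finite). -/
def Wfin {E : Type*} [MeasurableSpace E] (W : ℝ → ℝ → ℝ) (m : Measure (ℝ × E)) (u : ℝ) :
    FiniteMeasure E :=
  if h : IsFiniteMeasure (Wmeas W m u) then ⟨Wmeas W m u, h⟩ else 0

/-- Dirac mass as a finite measure. -/
def diracFM {E : Type*} [MeasurableSpace E] (x : E) : FiniteMeasure E :=
  ⟨Measure.dirac x, inferInstance⟩

/-- Borel σ-algebra on the space of finite measures with its weak topology. -/
instance {X : Type*} [MeasurableSpace X] [TopologicalSpace X] [OpensMeasurableSpace X] :
    MeasurableSpace (FiniteMeasure X) := borel _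

instance {X : Type*} [MeasurableSpace X] [TopologicalSpace X] [OpensMeasurableSpace X] :
    BorelSpace (FiniteMeasure X) := ⟨rfl⟩

/-- Borel σ-algebra on a space of continuous maps with the compact-open topology. -/
instance {X Y : Type*} [TopologicalSpace X] [TopologicalSpace Y] :
    MeasurableSpace C(X, Y) := borel _

instance {X Y : Type*} [TopologicalSpace X] [TopologicalSpace Y] :
    BorelSpace C(X, Y) := ⟨rfl⟩

instance {α : Type*} [TopologicalSpace α] [MeasurableSpace α] [BorelSpace α] {p : α → Prop} :
    BorelSpace {x // p x} := Subtype.borelSpace {x | p x}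

/-- The path space `C^d = C([0,T]; ℝ^d)`. -/
abbrev Cpath (d : ℕ) (T : ℝ) := C(Set.Icc (0:ℝ) T, Fin d → ℝ)

/-- The space `V` of relaxed controls: measures on `[0,T] × A` whose first marginal is the
Lebesgue measure on `[0,T]`. -/
abbrev RelaxedControls (T : ℝ) (A : Type*) [MetricSpace A] [MeasurableSpace A] [BorelSpace A] :=
  {q : FiniteMeasure (Set.Icc (0:ℝ) T × A) //
    (q : Measure (Set.Icc (0:ℝ) T × A)).map Prod.fst = MeasureTheory.volume.comap Subtype.val}

/-- The canonical space `V × [0,1] × C^d` of the relaxed formulation (with `[0,1]` modelled as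
`ℝ`, the label-marginal being the uniform measure on `[0,1]`). -/
abbrev GameSpace (d : ℕ) (T : ℝ) (A : Type*) [MetricSpace A] [MeasurableSpace A] [BorelSpace A] :=
  RelaxedControls T A × ℝ × Cpath d T

/-- `P_Unif([0,1] × C^d)`: probability measures on `[0,1] × C^d` with uniform first marginal. -/
abbrev PunifPath (d : ℕ) (T : ℝ) :=
  {μ : ProbabilityMeasure (ℝ × Cpath d T) //
    (μ : Measure (ℝ × Cpath d T)).map Prod.fst = unif01}

/-- Probability measures on `V × [0,1] × C^d` whose `[0,1]`-marginal is uniform. -/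
abbrev PunifGame (d : ℕ) (T : ℝ) (A : Type*) [MetricSpace A] [MeasurableSpace A] [BorelSpace A] :=
  {P : ProbabilityMeasure (GameSpace d T A) //
    (P : Measure (GameSpace d T A)).map (fun ω => ω.2.1) = unif01}

/-- A countable family of `[0,1]`-valued functions, rich enough to separate every point from the
complement of every neighbourhood by the values `1` and `0`. -/
structure IsBumpFamily {Y : Type*} [TopologicalSpace Y] (b : ℕ → Y → ℝ) : Prop where
  continuous : ∀ n, Continuous (b n)
  nonneg : ∀ n y, 0 ≤ b n y
  le_one : ∀ n y, b n y ≤ 1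
  separates : ∀ O : Set Y, IsOpen O → ∀ y ∈ O, ∃ n, b n y = 1 ∧ ∀ z ∉ O, b n z = 0

theorem exists_isBumpFamily (Y : Type*) [TopologicalSpace Y]
    [TopologicalSpace.PseudoMetrizableSpace Y] [TopologicalSpace.SeparableSpace Y] :
    ∃ b : ℕ → Y → ℝ, IsBumpFamily b := by
  let _ := TopologicalSpace.pseudoMetrizableSpacePseudoMetric Y
  rcases isEmpty_or_nonempty Y with hY | hY
  · exact ⟨fun _ _ => 0, fun _ => continuous_const, fun _ y => hY.elim y, fun _ y => hY.elim y,
      fun _ _ y => hY.elim y⟩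
  have hdense := TopologicalSpace.denseRange_denseSeq Y
  set z := TopologicalSpace.denseSeq Y
  refine ⟨fun n y => min 1 (max 0 (2 - n.unpair.1 * dist y (z n.unpair.2))),
    fun n => by fun_prop, fun n y => by positivity, fun n y => min_le_left _ _, ?_⟩
  intro O hO y hy
  obtain ⟨ε, hε, hball⟩ := Metric.isOpen_iff.1 hO y hy
  obtain ⟨k, hk⟩ := exists_nat_gt (3 / ε)
  have hk0 : (0 : ℝ) < k := lt_trans (by positivity) hk
  have hkε : 3 < k * ε := by rwa [div_lt_iff₀ hε] at hk
  obtain ⟨j, hj⟩ := hdense.exists_dist_lt y (one_div_pos.2 hk0)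
  have hj' : k * dist y (z j) < 1 := by
    rw [lt_div_iff₀ hk0] at hj
    linarith
  refine ⟨Nat.pair k j, ?_, ?_⟩
  · simp only [Nat.unpair_pair]
    exact min_eq_left (le_max_of_le_right (by linarith))
  · intro w hw
    have hdist : ε ≤ dist w y := not_lt.1 fun h => hw (hball (Metric.mem_ball.2 h))
    have htri := dist_triangle w (z j) y
    rw [dist_comm (z j) y] at htri
    have hfar : k * ε ≤ k * dist w (z j) + k * dist y (z j) := by
      rw [← mul_add]
      exact mul_le_mul_of_nonneg_left (hdist.trans htri) hk0.le
    simp only [Nat.unpair_pair]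
    rw [max_eq_left (by linarith)]
    simp

/-- A class of test functions on `Ω` stable under suprema and containing the products of a
measurable cut-off in the label `ℓ` with a multiple of a bump in the variable `β`. -/
structure IsTestClass {Ω L Y : Type*} [MeasurableSpace Ω] [MeasurableSpace L] (b : ℕ → Y → ℝ)
    (ℓ : Ω → L) (β : Ω → Y) (𝒢 : Set (Ω → ℝ)) : Prop where
  measurable : ∀ G ∈ 𝒢, Measurable G
  sup_mem : ∀ F ∈ 𝒢, ∀ G ∈ 𝒢, F ⊔ G ∈ 𝒢
  basic_mem : ∀ B : Set L, MeasurableSet B → ∀ (n : ℕ) (s : ℚ),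
    (fun ω => B.indicator 1 (ℓ ω) * (|(s : ℝ)| * b n (β ω))) ∈ 𝒢

section Convergence

variable {M L Y Ω ι : Type*} [TopologicalSpace M] [SecondCountableTopology M]
  [TopologicalSpace Y] [TopologicalSpace.SeparableSpace Y] [MeasurableSpace L] [MeasurableSpace Ω]
  {b : ℕ → Y → ℝ} {ℓ : Ω → L} {β : Ω → Y} {𝒢 : Set (Ω → ℝ)}
  {l : Filter ι} {P : ι → Measure Ω} {P₀ : Measure Ω} [IsFiniteMeasure P₀]
  [∀ i, IsFiniteMeasure (P i)] {H : M → L → Y → ℝ} {C : ℝ} {m : ι → M} {m₀ : M}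

/-- A nonnegative Carathéodory integrand is the supremum of countably many test functions, each of
which stays below the integrand for all parameters close to `m₀`. -/
theorem exists_lower_envelope (hb : IsBumpFamily b) (h𝒢 : IsTestClass b ℓ β 𝒢)
    (hH0 : ∀ m u y, 0 ≤ H m u y) (hHcont : ∀ u, Continuous fun p : M × Y => H p.1 u p.2)
    (hHmeas : ∀ m y, Measurable fun u => H m u y) (m₀ : M) :
    ∃ a : ℕ → Ω → ℝ, (∀ j, a j ∈ 𝒢) ∧ (∀ j ω, 0 ≤ a j ω) ∧
      (∀ j, ∀ᶠ m in 𝓝 m₀, ∀ ω, a j ω ≤ H m (ℓ ω) (β ω)) ∧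
      ∀ ω, ∀ c < H m₀ (ℓ ω) (β ω), ∃ j, c < a j ω := by
  obtain ⟨D, hDc, hD⟩ := TopologicalSpace.exists_countable_dense (M × Y)
  let K := TopologicalSpace.countableBasis M × ℕ × ℚ
  have hbasis := TopologicalSpace.isBasis_countableBasis M
  let B : K → Set L := fun k => {u | m₀ ∈ k.1.1 ∧
    ∀ p ∈ D, p.1 ∈ k.1.1 → |(k.2.2 : ℝ)| * b k.2.1 p.2 ≤ H p.1 u p.2}
  let a : K → Ω → ℝ := fun k ω => (B k).indicator 1 (ℓ ω) * (|(k.2.2 : ℝ)| * b k.2.1 (β ω))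
  have hBmeas : ∀ k, MeasurableSet (B k) := by
    intro k
    have hD' : MeasurableSet {u | ∀ p ∈ D, p.1 ∈ k.1.1 →
        |(k.2.2 : ℝ)| * b k.2.1 p.2 ≤ H p.1 u p.2} := by
      simp only [Set.ofPred_forall]
      refine MeasurableSet.biInter hDc fun p _ => MeasurableSet.iInter fun _ => ?_
      exact measurableSet_le measurable_const (hHmeas _ _)
    exact (MeasurableSet.const _).inter hD'
  have hext : ∀ k, ∀ u ∈ B k, ∀ m ∈ k.1.1, ∀ y, |(k.2.2 : ℝ)| * b k.2.1 y ≤ H m u y := by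
    intro k u hu m hm y
    have hUo : IsOpen (k.1.1 ×ˢ (Set.univ : Set Y)) :=
      (hbasis.isOpen k.1.2).prod isOpen_univ
    have hcl : IsClosed {p : M × Y | |(k.2.2 : ℝ)| * b k.2.1 p.2 ≤ H p.1 u p.2} :=
      isClosed_le (continuous_const.mul ((hb.continuous _).comp continuous_snd)) (hHcont u)
    have hsub : k.1.1 ×ˢ (Set.univ : Set Y) ∩ D ⊆
        {p : M × Y | |(k.2.2 : ℝ)| * b k.2.1 p.2 ≤ H p.1 u p.2} :=
      fun p hp => hu.2 p hp.2 hp.1.1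
    exact (hcl.closure_subset_iff.2 hsub) (hD.open_subset_closure_inter hUo
      (show (m, y) ∈ k.1.1 ×ˢ (Set.univ : Set Y) from ⟨hm, Set.mem_univ y⟩))
  have hann : ∀ k ω, 0 ≤ a k ω := fun k ω => mul_nonneg
    (Set.indicator_nonneg (fun _ _ => zero_le_one) _) (mul_nonneg (abs_nonneg _) (hb.nonneg _ _))
  have hale : ∀ k, ∀ m ∈ k.1.1, ∀ ω, a k ω ≤ H m (ℓ ω) (β ω) := by
    intro k m hm ω
    by_cases hu : ℓ ω ∈ B k
    · simpa [a, hu] using hext k _ hu m hm (β ω)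
    · simpa [a, hu] using hH0 m (ℓ ω) (β ω)
  obtain ⟨U₀, hU₀, -, -⟩ := hbasis.exists_subset_of_mem_open (Set.mem_univ m₀) isOpen_univ
  have : Nonempty K := ⟨⟨U₀, hU₀⟩, 0, 0⟩
  have : Countable (TopologicalSpace.countableBasis M) :=
    (TopologicalSpace.countable_countableBasis M).to_subtype
  obtain ⟨e, he⟩ := exists_surjective_nat K
  refine ⟨fun j => a (e j), fun j => h𝒢.basic_mem _ (hBmeas _) _ _, fun j => hann _, ?_, ?_⟩
  · intro j
    by_cases hm₀ : m₀ ∈ (e j).1.1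
    · filter_upwards [(hbasis.isOpen (e j).1.2).mem_nhds hm₀] with m hm
      exact hale _ m hm
    · refine Eventually.of_forall fun m ω => ?_
      have hu : ℓ ω ∉ B (e j) := fun h => hm₀ h.1
      simpa [a, hu] using hH0 m (ℓ ω) (β ω)
  · intro ω c hc
    suffices ∃ k, c < a k ω by
      obtain ⟨k, hk⟩ := this
      obtain ⟨j, rfl⟩ := he k
      exact ⟨j, hk⟩
    rcases (hH0 m₀ (ℓ ω) (β ω)).eq_or_lt with h0 | h0
    · exact ⟨Classical.arbitrary K, (hc.trans_eq h0.symm).trans_le (hann _ _)⟩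
    obtain ⟨s, hs, hsH⟩ := exists_rat_btwn (max_lt hc h0)
    have hs0 : (0 : ℝ) < s := (le_max_right _ _).trans_lt hs
    have hopen : IsOpen {p : M × Y | (s : ℝ) < H p.1 (ℓ ω) p.2} :=
      isOpen_lt continuous_const (hHcont _)
    obtain ⟨U, O, hU, hO, hmU, hyO, hUO⟩ := isOpen_prod_iff.1 hopen m₀ (β ω) hsH
    obtain ⟨U', hU', hmU', hU'U⟩ := hbasis.exists_subset_of_mem_open hmU hU
    obtain ⟨n, hn1, hn0⟩ := hb.separates O hO _ hyO
    have hmem : ℓ ω ∈ B (⟨U', hU'⟩, n, s) := by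
      refine ⟨hmU', fun p _ hp => ?_⟩
      by_cases hpO : p.2 ∈ O
      · have h1 : (s : ℝ) < H p.1 (ℓ ω) p.2 := hUO ⟨hU'U hp, hpO⟩
        simp only [abs_of_pos hs0]
        nlinarith [hb.le_one n p.2]
      · simpa [hn0 _ hpO] using hH0 p.1 (ℓ ω) p.2
    refine ⟨(⟨U', hU'⟩, n, s), ?_⟩
    simp only [a, Set.indicator_of_mem hmem, hn1, abs_of_pos hs0, Pi.one_apply, one_mul, mul_one]
    exact (le_max_left _ _).trans_lt hs

theorem eventually_lt_integral (hb : IsBumpFamily b) (h𝒢 : IsTestClass b ℓ β 𝒢)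
    (hconv : ∀ G ∈ 𝒢, Tendsto (fun i => ∫ ω, G ω ∂P i) l (𝓝 (∫ ω, G ω ∂P₀)))
    (hH0 : ∀ m u y, 0 ≤ H m u y) (hHC : ∀ m u y, H m u y ≤ C)
    (hHcont : ∀ u, Continuous fun p : M × Y => H p.1 u p.2)
    (hHmeas : ∀ m y, Measurable fun u => H m u y)
    (hHΩ : ∀ m, Measurable fun ω => H m (ℓ ω) (β ω)) (hm : Tendsto m l (𝓝 m₀))
    {c : ℝ} (hc : c < ∫ ω, H m₀ (ℓ ω) (β ω) ∂P₀) :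
    ∀ᶠ i in l, c < ∫ ω, H (m i) (ℓ ω) (β ω) ∂P i := by
  obtain ⟨a, ha𝒢, ha0, hale, hasup⟩ := exists_lower_envelope hb h𝒢 hH0 hHcont hHmeas m₀
  have hmem : ∀ N, partialSups a N ∈ 𝒢 := by
    intro N
    induction N with
    | zero => simpa using ha𝒢 0
    | succ N ih =>
      rw [partialSups_add_one]
      exact h𝒢.sup_mem _ ih _ (ha𝒢 _)
  have hnn : ∀ N ω, 0 ≤ partialSups a N ω := fun N ω =>
    (ha0 0 ω).trans (le_partialSups_of_le a (Nat.zero_le N) ω)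
  have hle : ∀ N, ∀ᶠ m in 𝓝 m₀, ∀ ω, partialSups a N ω ≤ H m (ℓ ω) (β ω) := by
    intro N
    induction N with
    | zero => simpa using hale 0
    | succ N ih =>
      filter_upwards [ih, hale (N + 1)] with m h1 h2 ω
      rw [partialSups_add_one]
      exact sup_le (h1 ω) (h2 ω)
  have hlim : Tendsto (fun N => ∫ ω, partialSups a N ω ∂P₀) atTop
      (𝓝 (∫ ω, H m₀ (ℓ ω) (β ω) ∂P₀)) := by
    refine tendsto_integral_of_dominated_convergence (fun _ => C)
      (fun N => (h𝒢.measurable _ (hmem N)).aestronglyMeasurable) (integrable_const C) ?_ ?_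
    · refine fun N => Eventually.of_forall fun ω => ?_
      rw [Real.norm_of_nonneg (hnn N ω)]
      exact ((hle N).self_of_nhds ω).trans (hHC _ _ _)
    · refine Eventually.of_forall fun ω => tendsto_order.2 ⟨fun c' hc' => ?_, fun c' hc' => ?_⟩
      · obtain ⟨j, hj⟩ := hasup ω c' hc'
        filter_upwards [eventually_ge_atTop j] with N hN
        exact hj.trans_le (le_partialSups_of_le a hN ω)
      · exact Eventually.of_forall fun N => ((hle N).self_of_nhds ω).trans_lt hc'
  obtain ⟨N, hN⟩ := (hlim.eventually_const_lt hc).exists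
  filter_upwards [(hconv _ (hmem N)).eventually_const_lt hN, hm.eventually (hle N)] with i h1 h2
  refine h1.trans_le (integral_mono_of_nonneg (Eventually.of_forall (hnn N)) ?_
    (Eventually.of_forall h2))
  refine Integrable.of_bound (hHΩ _).aestronglyMeasurable C (Eventually.of_forall fun ω => ?_)
  rw [Real.norm_of_nonneg (hH0 _ _ _)]
  exact hHC _ _ _

/-- Convergence of integrals of bounded Carathéodory integrands with a varying parameter, from
convergence of the integrals over a test class. -/
theorem tendsto_integral_of_isTestClass (hb : IsBumpFamily b) (h𝒢 : IsTestClass b ℓ β 𝒢)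
    (hconv : ∀ G ∈ 𝒢, Tendsto (fun i => ∫ ω, G ω ∂P i) l (𝓝 (∫ ω, G ω ∂P₀)))
    (hmass : Tendsto (fun i => (P i).real Set.univ) l (𝓝 (P₀.real Set.univ)))
    (hHC : ∀ m u y, |H m u y| ≤ C)
    (hHcont : ∀ u, Continuous fun p : M × Y => H p.1 u p.2)
    (hHmeas : ∀ m y, Measurable fun u => H m u y)
    (hHΩ : ∀ m, Measurable fun ω => H m (ℓ ω) (β ω)) (hm : Tendsto m l (𝓝 m₀)) :
    Tendsto (fun i => ∫ ω, H (m i) (ℓ ω) (β ω) ∂P i) l (𝓝 (∫ ω, H m₀ (ℓ ω) (β ω) ∂P₀)) := by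
  have hint : ∀ (Q : Measure Ω) [IsFiniteMeasure Q] (m : M),
      Integrable (fun ω => H m (ℓ ω) (β ω)) Q := fun Q _ m =>
    Integrable.of_bound (hHΩ m).aestronglyMeasurable C (Eventually.of_forall fun ω => hHC _ _ _)
  have hadd : ∀ (Q : Measure Ω) [IsFiniteMeasure Q] (m : M),
      ∫ ω, (C + H m (ℓ ω) (β ω)) ∂Q = Q.real Set.univ * C + ∫ ω, H m (ℓ ω) (β ω) ∂Q := by
    intro Q _ m
    rw [integral_add (integrable_const C) (hint Q m), integral_const, smul_eq_mul]
  have hsub : ∀ (Q : Measure Ω) [IsFiniteMeasure Q] (m : M),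
      ∫ ω, (C - H m (ℓ ω) (β ω)) ∂Q = Q.real Set.univ * C - ∫ ω, H m (ℓ ω) (β ω) ∂Q := by
    intro Q _ m
    rw [integral_sub (integrable_const C) (hint Q m), integral_const, smul_eq_mul]
  have hmassC := hmass.mul_const C
  refine tendsto_order.2 ⟨fun c hc => ?_, fun c hc => ?_⟩
  · obtain ⟨c', hcc', hc'⟩ := exists_between hc
    have hlow : P₀.real Set.univ * C + c' < ∫ ω, (C + H m₀ (ℓ ω) (β ω)) ∂P₀ := by
      rw [hadd]; linarith
    have hev := eventually_lt_integral (H := fun m u y => C + H m u y) (C := C + C) hb h𝒢 hconv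
      (fun m u y => by linarith [neg_le_of_abs_le (hHC m u y)])
      (fun m u y => by linarith [le_of_abs_le (hHC m u y)])
      (fun u => continuous_const.add (hHcont u)) (fun m y => (hHmeas m y).const_add C)
      (fun m => (hHΩ m).const_add C) hm hlow
    filter_upwards [hev, hmassC.eventually_lt_const (show _ < P₀.real Set.univ * C + (c' - c) by
      linarith)] with i h1 h2
    rw [hadd] at h1
    linarith
  · obtain ⟨c', hc', hcc'⟩ := exists_between hc
    have hlow : P₀.real Set.univ * C - c' < ∫ ω, (C - H m₀ (ℓ ω) (β ω)) ∂P₀ := by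
      rw [hsub]; linarith
    have hev := eventually_lt_integral (H := fun m u y => C - H m u y) (C := C + C) hb h𝒢 hconv
      (fun m u y => by linarith [le_of_abs_le (hHC m u y)])
      (fun m u y => by linarith [neg_le_of_abs_le (hHC m u y)])
      (fun u => continuous_const.sub (hHcont u)) (fun m y => (hHmeas m y).const_sub C)
      (fun m => (hHΩ m).const_sub C) hm hlow
    filter_upwards [hev, hmassC.eventually_lt_const (show _ < P₀.real Set.univ * C + (c - c') by
      linarith)] with i h1 h2
    rw [hsub] at h1
    linarith

end Convergence

section FiniteMeasures

variable {X : Type*} [TopologicalSpace X] [TopologicalSpace.SeparableSpace X]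
  [TopologicalSpace.PseudoMetrizableSpace X] [MeasurableSpace X] [OpensMeasurableSpace X]

omit [TopologicalSpace.SeparableSpace X] [TopologicalSpace.PseudoMetrizableSpace X] in
theorem FiniteMeasure.tendsto_real_univ {ι : Type*} {l : Filter ι} {ν : ι → FiniteMeasure X}
    {ν₀ : FiniteMeasure X} (h : Tendsto ν l (𝓝 ν₀)) :
    Tendsto (fun i => (ν i : Measure X).real Set.univ) l (𝓝 ((ν₀ : Measure X).real Set.univ)) := by
  simpa using FiniteMeasure.tendsto_iff_forall_integral_tendsto.1 h 1

/-- Integrating a jointly continuous bounded function depending on a parameter is jointly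
continuous in the parameter and the measure. -/
theorem FiniteMeasure.continuous_integral_param {M : Type*} [TopologicalSpace M]
    [SecondCountableTopology M] {H : M → X → ℝ} {C : ℝ} (hHC : ∀ m x, |H m x| ≤ C)
    (hH : Continuous fun p : M × X => H p.1 p.2) :
    Continuous fun p : M × FiniteMeasure X => ∫ x, H p.1 x ∂(p.2 : Measure X) := by
  refine continuous_iff_continuousAt.2 fun p => ?_
  obtain ⟨b, hb⟩ := exists_isBumpFamily X
  have hHc : ∀ m, Continuous (H m) := fun m => hH.comp (by fun_prop : Continuous fun x => (m, x))
  have hsnd : Tendsto (fun q : M × FiniteMeasure X => q.2) (𝓝 p) (𝓝 p.2) :=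
    continuous_snd.tendsto p
  refine tendsto_integral_of_isTestClass (H := fun m (_ : Unit) x => H m x) (ℓ := fun _ => ())
    (β := id) (𝒢 := {G | Continuous G ∧ ∃ C, ∀ x, |G x| ≤ C}) hb
    ⟨fun G hG => hG.1.measurable, ?_, ?_⟩ ?_ (FiniteMeasure.tendsto_real_univ hsnd)
    (fun m _ x => hHC m x) (fun _ => hH) (fun _ _ => measurable_const)
    (fun m => (hHc m).measurable) (continuous_fst.tendsto p)
  · rintro F ⟨hF, C₁, hC₁⟩ G ⟨hG, C₂, hC₂⟩
    exact ⟨hF.sup hG, max C₁ C₂, fun x => abs_max_le_max_abs_abs.trans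
      (max_le_max (hC₁ x) (hC₂ x))⟩
  · intro B _ n s
    refine ⟨continuous_const.mul (continuous_const.mul (hb.continuous n)),
      |B.indicator (1 : Unit → ℝ) ()| * |(s : ℝ)|, fun x => ?_⟩
    rw [abs_mul, abs_mul, abs_abs, abs_of_nonneg (hb.nonneg n _)]
    gcongr
    exact mul_le_of_le_one_right (abs_nonneg _) (hb.le_one n _)
  · rintro G ⟨hG, C', hC'⟩
    exact FiniteMeasure.tendsto_iff_forall_integral_tendsto.1 hsnd
      (BoundedContinuousFunction.ofNormedAddCommGroup G hG C' hC')

/-- Finite suprema of rational multiples of bump functions. -/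
def bumpSup (b : ℕ → X → ℝ) : List (ℕ × ℚ) → X → ℝ
  | [] => 0
  | p :: F => (fun x => |(p.2 : ℝ)| * b p.1 x) ⊔ bumpSup b F

omit [TopologicalSpace.SeparableSpace X] [TopologicalSpace.PseudoMetrizableSpace X]
  [MeasurableSpace X] [OpensMeasurableSpace X] in
theorem bumpSup_spec {b : ℕ → X → ℝ} (hb : IsBumpFamily b) (F : List (ℕ × ℚ)) :
    Continuous (bumpSup b F) ∧ (∀ x, 0 ≤ bumpSup b F x) ∧ ∃ C, ∀ x, |bumpSup b F x| ≤ C := by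
  induction F with
  | nil => exact ⟨continuous_const, fun _ => le_rfl, 0, fun x => by simp [bumpSup]⟩
  | cons p F ih =>
    obtain ⟨hc, h0, C, hC⟩ := ih
    refine ⟨(continuous_const.mul (hb.continuous _)).sup hc, fun x => le_sup_of_le_right (h0 x),
      max |(p.2 : ℝ)| C, fun x => abs_max_le_max_abs_abs.trans (max_le_max ?_ (hC x))⟩
    rw [abs_mul, abs_abs, abs_of_nonneg (hb.nonneg _ _)]
    exact mul_le_of_le_one_right (abs_nonneg _) (hb.le_one _ _)

omit [TopologicalSpace.SeparableSpace X] [TopologicalSpace.PseudoMetrizableSpace X]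
  [MeasurableSpace X] [OpensMeasurableSpace X] in
theorem bumpSup_append {b : ℕ → X → ℝ} (hb : IsBumpFamily b) (F F' : List (ℕ × ℚ)) :
    bumpSup b (F ++ F') = bumpSup b F ⊔ bumpSup b F' := by
  induction F with
  | nil => exact (sup_eq_right.2 (bumpSup_spec hb F').2.1).symm
  | cons p F ih => simp only [List.cons_append, bumpSup, ih, sup_assoc]

/-- The total mass and the integrals of the finite suprema of bumps, as coordinates on the space of
finite measures. -/
def bumpCoord (b : ℕ → X → ℝ) (ν : FiniteMeasure X) : Option (List (ℕ × ℚ)) → ℝ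
  | none => (ν : Measure X).real Set.univ
  | some F => ∫ x, bumpSup b F x ∂(ν : Measure X)

omit [TopologicalSpace.PseudoMetrizableSpace X] in
theorem isInducing_bumpCoord {b : ℕ → X → ℝ} (hb : IsBumpFamily b) :
    Topology.IsInducing (bumpCoord b : FiniteMeasure X → Option (List (ℕ × ℚ)) → ℝ) := by
  refine Topology.isInducing_iff_nhds.2 fun ν => le_antisymm ?_ ?_
  · refine Tendsto.le_comap (tendsto_pi_nhds.2 fun o => ?_)
    match o with
    | none => exact FiniteMeasure.tendsto_real_univ (tendsto_id (x := 𝓝 ν))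
    | some F =>
      obtain ⟨hc, -, C, hC⟩ := bumpSup_spec hb F
      exact FiniteMeasure.tendsto_iff_forall_integral_tendsto.1 (tendsto_id (x := 𝓝 ν))
        (BoundedContinuousFunction.ofNormedAddCommGroup _ hc C hC)
  · have hcoord := tendsto_pi_nhds.1
      (tendsto_comap : Tendsto (bumpCoord b) (comap (bumpCoord b) (𝓝 (bumpCoord b ν))) _)
    rw [← tendsto_id']
    refine FiniteMeasure.tendsto_iff_forall_integral_tendsto.2 fun φ => ?_
    refine tendsto_integral_of_isTestClass (M := Unit) (H := fun _ (_ : Unit) x => φ x)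
      (ℓ := fun _ => ()) (β := id) (𝒢 := Set.range (bumpSup b)) (C := ‖φ‖) (m := fun _ => ())
      (m₀ := ()) hb ⟨?_, ?_, ?_⟩ ?_ (hcoord none) (fun _ _ x => φ.norm_coe_le_norm x)
      (fun _ => φ.continuous.comp continuous_snd) (fun _ _ => measurable_const)
      (fun _ => φ.continuous.measurable) tendsto_const_nhds
    · rintro _ ⟨F, rfl⟩
      exact (bumpSup_spec hb F).1.measurable
    · rintro _ ⟨F, rfl⟩ _ ⟨F', rfl⟩
      exact ⟨F ++ F', bumpSup_append hb F F'⟩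
    · intro B _ n s
      by_cases hB : () ∈ B
      · refine ⟨[(n, s)], ?_⟩
        simp only [bumpSup, Set.indicator_of_mem hB, Pi.one_apply, one_mul, id]
        exact sup_eq_left.2 fun x => mul_nonneg (abs_nonneg _) (hb.nonneg _ _)
      · refine ⟨[], ?_⟩
        simp only [bumpSup, Set.indicator_of_notMem hB, zero_mul]
        rfl
    · rintro _ ⟨F, rfl⟩
      exact hcoord (some F)

instance FiniteMeasure.instSecondCountable : SecondCountableTopology (FiniteMeasure X) := by
  obtain ⟨b, hb⟩ := exists_isBumpFamily X
  exact (isInducing_bumpCoord hb).secondCountableTopology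

instance FiniteMeasure.instPseudoMetrizable :
    TopologicalSpace.PseudoMetrizableSpace (FiniteMeasure X) := by
  obtain ⟨b, hb⟩ := exists_isBumpFamily X
  exact (isInducing_bumpCoord hb).pseudoMetrizableSpace

instance ProbabilityMeasure.instSecondCountable :
    SecondCountableTopology (ProbabilityMeasure X) :=
  (ProbabilityMeasure.toFiniteMeasure_isEmbedding X).secondCountableTopology

theorem FiniteMeasure.measurable_of_integral {Ω : Type*} [MeasurableSpace Ω]
    {ν : Ω → FiniteMeasure X}
    (h : ∀ φ : BoundedContinuousFunction X ℝ, Measurable fun ω => ∫ x, φ x ∂(ν ω : Measure X)) :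
    Measurable ν := by
  obtain ⟨b, hb⟩ := exists_isBumpFamily X
  have hborel : borel (FiniteMeasure X) = MeasurableSpace.comap (bumpCoord b) (borel _) :=
    (congrArg (fun t => @borel _ t) (isInducing_bumpCoord hb).eq_induced).trans borel_comap
  rw [BorelSpace.measurable_eq (α := FiniteMeasure X), hborel,
    ← BorelSpace.measurable_eq (α := Option (List (ℕ × ℚ)) → ℝ), measurable_comap_iff]
  refine measurable_pi_iff.2 fun o => ?_
  match o with
  | none => simpa [bumpCoord] using h 1
  | some F =>
    obtain ⟨hc, -, C, hC⟩ := bumpSup_spec hb F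
    exact h (BoundedContinuousFunction.ofNormedAddCommGroup _ hc C hC)

/-- Joint continuity of the image of a finite measure under a continuously parametrized map. -/
theorem FiniteMeasure.continuous_map_param {S E : Type*} [TopologicalSpace S]
    [SecondCountableTopology S] [TopologicalSpace E] [MeasurableSpace E] [BorelSpace E]
    {e : S → X → E} (he : Continuous fun p : S × X => e p.1 p.2) :
    Continuous fun p : S × FiniteMeasure X => p.2.map (e p.1) := by
  refine continuous_iff_continuousAt.2 fun p =>
    FiniteMeasure.tendsto_iff_forall_integral_tendsto.2 fun φ => ?_
  have hes : ∀ s, Continuous (e s) := fun s => he.comp (by fun_prop : Continuous fun x => (s, x))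
  have hmap : ∀ q : S × FiniteMeasure X, ∫ y, φ y ∂(q.2.map (e q.1) : Measure E) =
      ∫ x, φ (e q.1 x) ∂(q.2 : Measure X) := fun q => by
    rw [FiniteMeasure.toMeasure_map,
      integral_map (hes _).measurable.aemeasurable φ.continuous.measurable.aestronglyMeasurable]
  simp only [hmap]
  exact (FiniteMeasure.continuous_integral_param (H := fun s x => φ (e s x))
    (fun s x => φ.norm_coe_le_norm _) (φ.continuous.comp he)).tendsto p

end FiniteMeasures

instance : IsProbabilityMeasure unif01 := ⟨by simp [unif01]⟩

section Labels

variable {Ω : Type*} [TopologicalSpace Ω] [MeasurableSpace Ω]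

/-- Measurable functions which, up to an error controlled by an arbitrarily small integrable
function of the label, are bounded and continuous. -/
structure IsLabelApprox (ℓ : Ω → ℝ) (G : Ω → ℝ) : Prop where
  measurable : Measurable G
  approx : ∀ ε > 0, ∃ (G' : BoundedContinuousFunction Ω ℝ) (c : ℝ → ℝ),
    Integrable c unif01 ∧ ∫ u, c u ∂unif01 ≤ ε ∧ ∀ ω, |G ω - G' ω| ≤ c (ℓ ω)

variable [OpensMeasurableSpace Ω] {ℓ : Ω → ℝ}

omit [OpensMeasurableSpace Ω] in
theorem IsLabelApprox.sup {F G : Ω → ℝ} (hF : IsLabelApprox ℓ F) (hG : IsLabelApprox ℓ G) :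
    IsLabelApprox ℓ (F ⊔ G) := by
  refine ⟨hF.measurable.sup hG.measurable, fun ε hε => ?_⟩
  obtain ⟨F', c, hc, hcε, hFc⟩ := hF.approx (ε / 2) (half_pos hε)
  obtain ⟨G', c', hc', hcε', hGc⟩ := hG.approx (ε / 2) (half_pos hε)
  refine ⟨F' ⊔ G', fun u => c u + c' u, hc.add hc', ?_, fun ω => ?_⟩
  · rw [integral_add hc hc']
    linarith
  · refine (abs_max_sub_max_le_max _ _ _ _).trans (max_le ?_ ?_)
    · exact (hFc ω).trans (le_add_of_nonneg_right ((abs_nonneg _).trans (hGc ω)))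
    · exact (hGc ω).trans (le_add_of_nonneg_left ((abs_nonneg _).trans (hFc ω)))

theorem isLabelApprox_mul (hℓ : Continuous ℓ) {w : ℝ → ℝ} (hw : Measurable w)
    (hwint : Integrable w unif01) (ψ : BoundedContinuousFunction Ω ℝ) :
    IsLabelApprox ℓ fun ω => w (ℓ ω) * ψ ω := by
  have : unif01.WeaklyRegular := inferInstance
  refine ⟨(hw.comp hℓ.measurable).mul ψ.continuous.measurable, fun ε hε => ?_⟩
  have hpos : 0 < ‖ψ‖ + 1 := by positivity
  obtain ⟨g, hg, hgint⟩ := hwint.exists_boundedContinuous_integral_sub_le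
    (div_pos hε hpos)
  refine ⟨g.compContinuous ⟨ℓ, hℓ⟩ * ψ, fun u => ‖w u - g u‖ * (‖ψ‖ + 1),
    (hwint.sub hgint).norm.mul_const _, ?_, fun ω => ?_⟩
  · rw [integral_mul_const]
    exact (le_div_iff₀ hpos).1 hg
  · have h1 := ψ.norm_coe_le_norm ω
    simp only [BoundedContinuousFunction.coe_mul, Pi.mul_apply,
      BoundedContinuousFunction.compContinuous_apply, ContinuousMap.coe_mk, ← sub_mul, abs_mul]
    exact mul_le_mul_of_nonneg_left (h1.trans (by linarith)) (abs_nonneg _)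

theorem abs_integral_sub_integral_le (hℓ : Continuous ℓ) {G : Ω → ℝ} (hG : Measurable G)
    {G' : BoundedContinuousFunction Ω ℝ} {c : ℝ → ℝ} (hc : Integrable c unif01)
    (hGc : ∀ ω, |G ω - G' ω| ≤ c (ℓ ω)) {Q : Measure Ω} [IsFiniteMeasure Q]
    (hQ : Q.map ℓ = unif01) :
    |∫ ω, G ω ∂Q - ∫ ω, G' ω ∂Q| ≤ ∫ u, c u ∂unif01 := by
  have hcQ : Integrable (fun ω => c (ℓ ω)) Q :=
    (integrable_map_measure (hQ ▸ hc.aestronglyMeasurable) hℓ.measurable.aemeasurable).1 (hQ ▸ hc)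
  have hG'Q : Integrable G' Q := G'.integrable Q
  have hsub : Integrable (fun ω => G ω - G' ω) Q :=
    hcQ.mono' (hG.sub G'.continuous.measurable).aestronglyMeasurable (Eventually.of_forall hGc)
  have hGQ : Integrable G Q := (hsub.add hG'Q).congr
    (Eventually.of_forall fun ω => sub_add_cancel _ _)
  rw [← integral_sub hGQ hG'Q, ← hQ, integral_map hℓ.measurable.aemeasurable
    (hQ ▸ hc.aestronglyMeasurable)]
  exact (abs_integral_le_integral_abs).trans (integral_mono hsub.abs hcQ hGc)

/-- Under a fixed uniform label marginal, weak convergence upgrades to convergence of the integrals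
of functions that are merely integrable in the label. -/
theorem IsLabelApprox.tendsto_integral (hℓ : Continuous ℓ) {G : Ω → ℝ} (hG : IsLabelApprox ℓ G)
    {ι : Type*} {l : Filter ι} {P : ι → ProbabilityMeasure Ω} {P₀ : ProbabilityMeasure Ω}
    (hP : Tendsto P l (𝓝 P₀)) (hPℓ : ∀ i, (P i : Measure Ω).map ℓ = unif01)
    (hPℓ₀ : (P₀ : Measure Ω).map ℓ = unif01) :
    Tendsto (fun i => ∫ ω, G ω ∂(P i : Measure Ω)) l (𝓝 (∫ ω, G ω ∂(P₀ : Measure Ω))) := by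
  refine Metric.tendsto_nhds.2 fun ε hε => ?_
  obtain ⟨G', c, hc, hcε, hGc⟩ := hG.approx (ε / 4) (by positivity)
  have hconv := ProbabilityMeasure.tendsto_iff_forall_integral_tendsto.1 hP G'
  filter_upwards [Metric.tendsto_nhds.1 hconv (ε / 4) (by positivity)] with i hi
  have h1 := abs_le.1 (abs_integral_sub_integral_le hℓ hG.measurable hc hGc (hPℓ i))
  have h2 := abs_le.1 (abs_integral_sub_integral_le hℓ hG.measurable hc hGc hPℓ₀)
  rw [Real.dist_eq] at hi ⊢
  have h3 := abs_lt.1 hi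
  exact abs_lt.2 ⟨by linarith [h1.1, h2.2, h3.1], by linarith [h1.2, h2.1, h3.2]⟩

/-- Joint continuity in the parameter and the measure of integrals of bounded integrands that are
measurable in the label and jointly continuous in the remaining variables. -/
theorem continuous_integral_of_label {M Y : Type*} [TopologicalSpace M]
    [SecondCountableTopology M] [TopologicalSpace Y] [SecondCountableTopology Y]
    [TopologicalSpace.MetrizableSpace Y] {β : Ω → Y} (hℓ : Continuous ℓ) (hβ : Continuous β)
    {H : M → ℝ → Y → ℝ} {C : ℝ} (hHC : ∀ m u y, |H m u y| ≤ C)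
    (hHcont : ∀ u, Continuous fun p : M × Y => H p.1 u p.2)
    (hHmeas : ∀ m y, Measurable fun u => H m u y) :
    Continuous fun z : M × {P : ProbabilityMeasure Ω // (P : Measure Ω).map ℓ = unif01} =>
      ∫ ω, H z.1 (ℓ ω) (β ω) ∂(z.2.1 : Measure Ω) := by
  refine continuous_iff_continuousAt.2 fun z => ?_
  borelize Y
  obtain ⟨b, hb⟩ := exists_isBumpFamily Y
  have hsnd : Tendsto (fun w : M × {P : ProbabilityMeasure Ω // (P : Measure Ω).map ℓ = unif01} =>
      w.2.1) (𝓝 z) (𝓝 z.2.1) := (continuous_subtype_val.comp continuous_snd).tendsto z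
  refine tendsto_integral_of_isTestClass (𝒢 := {G | IsLabelApprox ℓ G}) hb
    ⟨fun G hG => hG.measurable, fun F hF G hG => hF.sup hG, ?_⟩
    (fun G hG => hG.tendsto_integral hℓ hsnd (fun w => w.2.2) z.2.2) (by simp) hHC hHcont hHmeas
    (fun m => ?_) (continuous_fst.tendsto z)
  · intro B hB n s
    refine isLabelApprox_mul hℓ (measurable_one.indicator hB)
      ((integrable_const 1).indicator hB)
      (BoundedContinuousFunction.ofNormedAddCommGroup (fun ω => |(s : ℝ)| * b n (β ω))
        (continuous_const.mul ((hb.continuous n).comp hβ)) |(s : ℝ)| fun ω => ?_)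
    rw [norm_mul, Real.norm_eq_abs, abs_abs, Real.norm_of_nonneg (hb.nonneg _ _)]
    exact mul_le_of_le_one_right (abs_nonneg _) (hb.le_one _ _)
  · have hjoint : Measurable (Function.uncurry fun y u => H m u y) :=
      measurable_uncurry_of_continuous_of_measurable
        (fun u => (hHcont u).comp (by fun_prop : Continuous fun y => (m, y))) (hHmeas m)
    exact hjoint.comp (hβ.measurable.prodMk hℓ.measurable)

end Labels

section KernelMeasures

variable {E F : Type*} [MeasurableSpace E] [MeasurableSpace F] {W : ℝ → ℝ → ℝ}

theorem toMeasure_Wfin {m : Measure (ℝ × E)} {u : ℝ} (h : IsFiniteMeasure (Wmeas W m u)) :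
    (Wfin W m u : Measure E) = Wmeas W m u := by
  have hW : Wfin W m u = ⟨Wmeas W m u, h⟩ := by
    unfold Wfin
    exact dif_pos h
  rw [hW]
  rfl

theorem Wfin_of_not_isFiniteMeasure {m : Measure (ℝ × E)} {u : ℝ}
    (h : ¬IsFiniteMeasure (Wmeas W m u)) : Wfin W m u = 0 := by
  unfold Wfin
  exact dif_neg h

theorem Wmeas_map {e : E → F} (he : Measurable e) (m : Measure (ℝ × E)) {u : ℝ}
    (hW : Measurable (W u)) :
    Wmeas W (m.map fun p => (p.1, e p.2)) u = (Wmeas W m u).map e := by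
  have hpair : Measurable fun p : ℝ × E => (p.1, e p.2) := by fun_prop
  ext s hs
  rw [Measure.map_apply he hs, Wmeas, Wmeas, Measure.map_apply measurable_snd hs,
    Measure.map_apply measurable_snd (he hs), withDensity_apply _ (measurable_snd hs),
    withDensity_apply _ (measurable_snd (he hs)), setLIntegral_map (measurable_snd hs)
      (by fun_prop) hpair]
  rfl

theorem Wmeas_univ (m : Measure (ℝ × E)) {u : ℝ} (hW : Measurable (W u)) :
    Wmeas W m u Set.univ = ∫⁻ v, ENNReal.ofReal (W u v) ∂m.map Prod.fst := by
  rw [Wmeas, Measure.map_apply measurable_snd .univ, withDensity_apply _ (measurable_snd .univ),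
    lintegral_map (by fun_prop) measurable_fst]
  simp

theorem isFiniteMeasure_Wmeas_iff {m : Measure (ℝ × E)} (hm : m.map Prod.fst = unif01) {u : ℝ}
    (hW : Measurable (W u)) :
    IsFiniteMeasure (Wmeas W m u) ↔ ∫⁻ v, ENNReal.ofReal (W u v) ∂unif01 < ∞ := by
  rw [isFiniteMeasure_iff, Wmeas_univ m hW, hm]

theorem Wfin_map {e : E → F} (he : Measurable e) {m : Measure (ℝ × E)}
    (hm : m.map Prod.fst = unif01) {u : ℝ} (hW : Measurable (W u)) :
    Wfin W (m.map fun p => (p.1, e p.2)) u = (Wfin W m u).map e := by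
  have hpair : Measurable fun p : ℝ × E => (p.1, e p.2) := by fun_prop
  have hm' : (m.map fun p => (p.1, e p.2)).map Prod.fst = unif01 := by
    rw [Measure.map_map measurable_fst hpair, ← hm]
    rfl
  have h1 := isFiniteMeasure_Wmeas_iff hm hW
  have h2 := isFiniteMeasure_Wmeas_iff hm' hW
  apply FiniteMeasure.toMeasure_injective
  rw [FiniteMeasure.toMeasure_map]
  by_cases h : IsFiniteMeasure (Wmeas W m u)
  · rw [toMeasure_Wfin h, toMeasure_Wfin (h2.2 (h1.1 h)), Wmeas_map he m hW]
  · rw [Wfin_of_not_isFiniteMeasure h,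
      Wfin_of_not_isFiniteMeasure fun h' => h (h1.2 (h2.1 h'))]
    simp

theorem integral_Wfin (hW : Measurable fun p : ℝ × ℝ => W p.1 p.2) {m : Measure (ℝ × E)}
    (hm : m.map Prod.fst = unif01) (u : ℝ) {φ : E → ℝ} (hφ : Measurable φ) :
    ∫ x, φ x ∂(Wfin W m u : Measure E) =
      if ∫⁻ v, ENNReal.ofReal (W u v) ∂unif01 < ∞ then
        ∫ p, (ENNReal.ofReal (W u p.1)).toReal * φ p.2 ∂m else 0 := by
  have hWu : Measurable (W u) := hW.comp measurable_prodMk_left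
  have hfin := isFiniteMeasure_Wmeas_iff hm hWu
  split_ifs with h
  · rw [toMeasure_Wfin (hfin.2 h), Wmeas, integral_map measurable_snd.aemeasurable hφ.aestronglyMeasurable,
      integral_withDensity_eq_integral_toReal_smul (by fun_prop) (by simp)]
    rfl
  · rw [Wfin_of_not_isFiniteMeasure (hfin.not.2 h)]
    simp

variable [TopologicalSpace E]

theorem continuous_Wfin [OpensMeasurableSpace E] [OpensMeasurableSpace (ℝ × E)]
    (hW : Measurable fun p : ℝ × ℝ => W p.1 p.2) (u : ℝ) :
    Continuous fun μ : {μ : ProbabilityMeasure (ℝ × E) //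
      (μ : Measure (ℝ × E)).map Prod.fst = unif01} => Wfin W (μ.1 : Measure (ℝ × E)) u := by
  have hWu : Measurable (W u) := hW.comp measurable_prodMk_left
  refine continuous_iff_continuousAt.2 fun μ =>
    FiniteMeasure.tendsto_iff_forall_integral_tendsto.2 fun φ => ?_
  simp only [fun μ : {μ : ProbabilityMeasure (ℝ × E) //
    (μ : Measure (ℝ × E)).map Prod.fst = unif01} => integral_Wfin hW μ.2 u φ.continuous.measurable]
  split_ifs with h
  · have hmeas : Measurable fun v => ENNReal.ofReal (W u v) := by fun_prop
    exact (isLabelApprox_mul continuous_fst hmeas.ennreal_toReal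
      (integrable_toReal_of_lintegral_ne_top hmeas.aemeasurable h.ne)
      (φ.compContinuous ⟨Prod.snd, continuous_snd⟩)).tendsto_integral continuous_fst
      (continuous_subtype_val.tendsto μ) (fun μ => μ.2) μ.2
  · exact tendsto_const_nhds

theorem measurable_Wfin [OpensMeasurableSpace E] [TopologicalSpace.SeparableSpace E]
    [TopologicalSpace.PseudoMetrizableSpace E] (hW : Measurable fun p : ℝ × ℝ => W p.1 p.2)
    {m : Measure (ℝ × E)} [IsFiniteMeasure m] (hm : m.map Prod.fst = unif01) :
    Measurable (Wfin W m) := by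
  refine FiniteMeasure.measurable_of_integral fun φ => ?_
  simp only [integral_Wfin hW hm _ φ.continuous.measurable]
  have hW' : Measurable fun p : ℝ × ℝ => ENNReal.ofReal (W p.1 p.2) := hW.ennreal_ofReal
  refine Measurable.ite (measurableSet_lt hW'.lintegral_prod_right' measurable_const) ?_
    measurable_const
  have hjoint : Measurable fun p : ℝ × ℝ × E =>
      (ENNReal.ofReal (W p.1 p.2.1)).toReal * φ p.2.2 :=
    (hW'.comp (measurable_fst.prodMk (measurable_fst.comp measurable_snd))).ennreal_toReal.mul
      (φ.continuous.measurable.comp (measurable_snd.comp measurable_snd))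
  exact (hjoint.stronglyMeasurable.integral_prod_right' (ν := m)).measurable

end KernelMeasures

/-- joint continuity of the relaxed objective `(μ, P) ↦ ⟨P, Γ^μ⟩`.  Let
`W ∈ L¹₊[0,1]²`, `A` a compact metric space, `T > 0`, and `f`, `g` bounded continuous objective
functions (the measure argument carrying the weak topology of `M₊(ℝ^d)`).  Then
`(μ, P) ↦ ∫_{V × [0,1] × C^d} Γ^μ dP` is jointly continuous, where `μ_t` is the image of `μ`
under `(u,x) ↦ (u, x_t)` and
`Γ^μ(q,u,x) = g(x_T, Wμ_T(u)) + ∫_{[0,T]×A} f(t, x_t, Wμ_t(u), a) q(dt,da)`. -/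
theorem relaxed_objective_jointly_continuous
    {d : ℕ} {T : ℝ} (hT : 0 < T)
    {A : Type*} [MetricSpace A] [CompactSpace A] [MeasurableSpace A] [BorelSpace A]
    (W : ℝ → ℝ → ℝ)
    (hWmeas : Measurable fun p : ℝ × ℝ => W p.1 p.2)
    (hWint : Integrable (fun p : ℝ × ℝ => W p.1 p.2) (unif01.prod unif01))
    (hWnonneg : ∀ᵐ p ∂unif01.prod unif01, 0 ≤ W p.1 p.2)
    (f : Set.Icc (0:ℝ) T → (Fin d → ℝ) → FiniteMeasure (Fin d → ℝ) → A → ℝ)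
    (hfcont : Continuous
      fun q : Set.Icc (0:ℝ) T × (Fin d → ℝ) × FiniteMeasure (Fin d → ℝ) × A =>
        f q.1 q.2.1 q.2.2.1 q.2.2.2)
    (hfbdd : ∃ C, ∀ t x m a, |f t x m a| ≤ C)
    (g : (Fin d → ℝ) → FiniteMeasure (Fin d → ℝ) → ℝ)
    (hgcont : Continuous fun q : (Fin d → ℝ) × FiniteMeasure (Fin d → ℝ) => g q.1 q.2)
    (hgbdd : ∃ C, ∀ x m, |g x m| ≤ C) :
    Continuous (fun z : PunifPath d T × PunifGame d T A =>
      ∫ ω : GameSpace d T A,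
        (g (ω.2.2 ⟨T, Set.right_mem_Icc.2 hT.le⟩)
            (Wfin W ((z.1.1 : Measure (ℝ × Cpath d T)).map
                fun p => (p.1, p.2 ⟨T, Set.right_mem_Icc.2 hT.le⟩)) ω.2.1)
          + ∫ ta : Set.Icc (0:ℝ) T × A,
              f ta.1 (ω.2.2 ta.1)
                (Wfin W ((z.1.1 : Measure (ℝ × Cpath d T)).map
                    fun p => (p.1, p.2 ta.1)) ω.2.1) ta.2
              ∂(ω.1.1 : Measure (Set.Icc (0:ℝ) T × A)))
        ∂(z.2.1 : Measure (GameSpace d T A))) := by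
  obtain ⟨Cf, hCf⟩ := hfbdd
  obtain ⟨Cg, hCg⟩ := hgbdd
  set tT : Set.Icc (0 : ℝ) T := ⟨T, Set.right_mem_Icc.2 hT.le⟩
  have hWu : ∀ u, Measurable (W u) := fun u => hWmeas.comp measurable_prodMk_left
  have heval : ∀ t : Set.Icc (0 : ℝ) T, Measurable fun x : Cpath d T => x t :=
    fun t => Continuous.measurable (by fun_prop)
  have hWt : ∀ (μ : PunifPath d T) (t : Set.Icc (0 : ℝ) T) (u : ℝ),
      Wfin W ((μ.1 : Measure (ℝ × Cpath d T)).map fun p => (p.1, p.2 t)) u =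
        (Wfin W (μ.1 : Measure (ℝ × Cpath d T)) u).map fun x => x t :=
    fun μ t u => Wfin_map (heval t) μ.2 (hWu u)
  have hmarg : Continuous fun p : Set.Icc (0 : ℝ) T × FiniteMeasure (Cpath d T) =>
      p.2.map fun x => x p.1 :=
    FiniteMeasure.continuous_map_param (e := fun (t : Set.Icc (0 : ℝ) T) (x : Cpath d T) => x t)
      (by fun_prop)
  have hWfin := fun u => continuous_Wfin (E := Cpath d T) hWmeas u
  have hWcont : ∀ u, Continuous fun p : PunifPath d T × Set.Icc (0 : ℝ) T =>
      (Wfin W (p.1.1 : Measure (ℝ × Cpath d T)) u).map fun x => x p.2 := fun u =>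
    hmarg.comp (continuous_snd.prodMk ((hWfin u).comp continuous_fst))
  have hWmeasurable : ∀ (μ : PunifPath d T) (t : Set.Icc (0 : ℝ) T), Measurable fun u =>
      (Wfin W (μ.1 : Measure (ℝ × Cpath d T)) u).map fun x => x t := fun μ t =>
    (hmarg.comp (by fun_prop : Continuous fun ν => (t, ν))).measurable.comp
      (measurable_Wfin hWmeas μ.2)
  have hvol : ∀ q : RelaxedControls T A, (q.1 : Measure (Set.Icc (0 : ℝ) T × A)).real Set.univ = T := by
    intro q
    rw [measureReal_def, ← Set.preimage_univ (f := Prod.fst),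
      ← Measure.map_apply measurable_fst .univ, q.2,
      comap_subtype_coe_apply measurableSet_Icc]
    rw [Set.image_univ, Subtype.range_coe, Real.volume_Icc, sub_zero, ENNReal.toReal_ofReal hT.le]
  have : SecondCountableTopology (PunifPath d T) :=
    Topology.IsEmbedding.subtypeVal.secondCountableTopology
  have : SecondCountableTopology (RelaxedControls T A) :=
    Topology.IsEmbedding.subtypeVal.secondCountableTopology
  have : TopologicalSpace.PseudoMetrizableSpace (RelaxedControls T A) :=
    Topology.IsInducing.subtypeVal.pseudoMetrizableSpace
  simp only [hWt]
  refine continuous_integral_of_label (Ω := GameSpace d T A) (M := PunifPath d T)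
    (Y := RelaxedControls T A × Cpath d T) (ℓ := fun ω => ω.2.1) (β := fun ω => (ω.1, ω.2.2))
    (C := Cg + Cf * T)
    (H := fun μ u y => g (y.2 tT) ((Wfin W (μ.1 : Measure (ℝ × Cpath d T)) u).map fun x => x tT)
      + ∫ ta : Set.Icc (0 : ℝ) T × A, f ta.1 (y.2 ta.1)
          ((Wfin W (μ.1 : Measure (ℝ × Cpath d T)) u).map fun x => x ta.1) ta.2
          ∂(y.1.1 : Measure (Set.Icc (0 : ℝ) T × A)))
    (by fun_prop) (by fun_prop) ?_ ?_ ?_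
  · intro μ u y
    refine (abs_add_le _ _).trans (add_le_add (hCg _ _) ?_)
    have hbound := norm_integral_le_of_norm_le_const (μ := (y.1.1 : Measure (Set.Icc (0 : ℝ) T × A)))
      (f := fun ta => f ta.1 (y.2 ta.1)
        ((Wfin W (μ.1 : Measure (ℝ × Cpath d T)) u).map fun x => x ta.1) ta.2) (C := Cf)
      (Eventually.of_forall fun ta => hCf _ _ _ _)
    rwa [hvol] at hbound
  · intro u
    refine Continuous.add (hgcont.comp (Continuous.prodMk (by fun_prop)
      ((hWcont u).comp (by fun_prop : Continuous fun p : PunifPath d T ×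
        RelaxedControls T A × Cpath d T => (p.1, tT))))) ?_
    have hint : Continuous fun p : (PunifPath d T × Cpath d T) × (Set.Icc (0 : ℝ) T × A) =>
        f p.2.1 (p.1.2 p.2.1) ((Wfin W (p.1.1.1 : Measure (ℝ × Cpath d T)) u).map
          fun x => x p.2.1) p.2.2 :=
      hfcont.comp (Continuous.prodMk (by fun_prop) (Continuous.prodMk (by fun_prop)
        (Continuous.prodMk ((hWcont u).comp (by fun_prop : Continuous
          fun p : (PunifPath d T × Cpath d T) × (Set.Icc (0 : ℝ) T × A) => (p.1.1, p.2.1)))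
          (by fun_prop))))
    exact (FiniteMeasure.continuous_integral_param (X := Set.Icc (0 : ℝ) T × A)
      (M := PunifPath d T × Cpath d T)
      (H := fun p ta => f ta.1 (p.2 ta.1) ((Wfin W (p.1.1 : Measure (ℝ × Cpath d T)) u).map
          fun x => x ta.1) ta.2) (fun _ _ => hCf _ _ _ _) hint).comp
      (by fun_prop : Continuous fun p : PunifPath d T × RelaxedControls T A × Cpath d T =>
        ((p.1, p.2.2), p.2.1.1))
  · rintro μ ⟨q, x⟩
    refine Measurable.add ?_ ?_
    · exact (hgcont.comp (by fun_prop : Continuous fun ν => (x tT, ν))).measurable.comp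
        (hWmeasurable μ tT)
    · have hjoint : Measurable (Function.uncurry fun (ta : Set.Icc (0 : ℝ) T × A) u =>
          f ta.1 (x ta.1) ((Wfin W (μ.1 : Measure (ℝ × Cpath d T)) u).map fun x => x ta.1) ta.2) := by
        refine measurable_uncurry_of_continuous_of_measurable (fun u => ?_) fun ta => ?_
        · exact hfcont.comp (Continuous.prodMk (by fun_prop) (Continuous.prodMk (by fun_prop)
            (Continuous.prodMk ((hWcont u).comp (by fun_prop : Continuous
              fun ta : Set.Icc (0 : ℝ) T × A => (μ, ta.1))) (by fun_prop))))
        · exact (hfcont.comp (by fun_prop : Continuous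
            fun ν => (ta.1, x ta.1, ν, ta.2))).measurable.comp (hWmeasurable μ ta.1)
      exact (hjoint.stronglyMeasurable.integral_prod_left'
        (μ := (q.1 : Measure (Set.Icc (0 : ℝ) T × A)))).measurable

end
end

section
/- Let E be a Polish space and W ∈ L¹₊[0,1]² a nonnegative kernel. Assume: the step kernels W_{ξⁿ} converge to W in the strong operator topology; (1/n³) Σ_{i,j=1}^n (ξⁿ_{ij})² → 0; the map [0,1] ∋ u ↦ W(u,v)dv ∈ M₊([0,1]) is weakly continuous; and μ ∈ P_Unif([0,1] × E) admits a disintegration u ↦ μ_u that is weakly continuous. Then lim_{n→∞} sup_{(u₁,…,uₙ) ∈ Iⁿ₁×⋯×Iⁿₙ} (1/n) Σ_{i=1}^n E‖ M^{n,u}ᵢ − Wμ(uᵢ) ‖_BL = 0. -/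
open MeasureTheory ProbabilityTheory Filter Set
open scoped NNReal ENNReal Topology

noncomputable section

/-- `Iseg n i` is the interval `Iⁿ_{i+1} = [i/n, (i+1)/n)` (`0`-indexed); the last one is
`[(n-1)/n, 1]`. -/
def Iseg (n i : ℕ) : Set ℝ :=
  if i + 1 = n then Set.Icc ((i : ℝ) / n) 1 else Set.Ico ((i : ℝ) / n) (((i : ℝ) + 1) / n)

/-- The index `i` such that `u ∈ Iseg n i`, for `u ∈ [0,1]`. -/
def idx (n : ℕ) (u : ℝ) : ℕ := min (n - 1) ⌊(n : ℝ) * u⌋₊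

/-- The step kernel `W_ξ` associated with an `n × n` matrix `ξ` with nonnegative entries. -/
def Wstep (n : ℕ) (ξ : ℕ → ℕ → ℝ≥0) : ℝ → ℝ → ℝ := fun u v => (ξ (idx n u) (idx n v) : ℝ)

/-- Convergence of kernels in the strong operator topology, for operators `L^∞[0,1] → L¹[0,1]`:
`∫₀¹ |∫₀¹ (Wₙ(u,v) − W(u,v)) ψ(v) dv| du → 0` for every bounded measurable `ψ`. -/
def StrongOpTendsto (Wn : ℕ → ℝ → ℝ → ℝ) (W : ℝ → ℝ → ℝ) : Prop :=
  ∀ ψ : ℝ → ℝ, Measurable ψ → (∃ C, ∀ v, |ψ v| ≤ C) →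
    Tendsto (fun n => ∫ u, |∫ v, (Wn n u v - W u v) * ψ v ∂unif01| ∂unif01) atTop (𝓝 0)

/-- The bounded-Lipschitz norm `‖ν − Wμ(u)‖_BL`, where the pairing of `Wμ(u)` with a test
function `φ` is `∫_{[0,1]×E} W(u,v) φ(x) μ(dv,dx)`:  the supremum of
`∫ φ dν − ⟨Wμ(u), φ⟩` over all `1`-Lipschitz `φ : E → [−1,1]`. -/
def blDiff {E : Type*} [MetricSpace E] [MeasurableSpace E] (ν : Measure E)
    (W : ℝ → ℝ → ℝ) (μ : Measure (ℝ × E)) (u : ℝ) : ℝ :=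
  sSup {r : ℝ | ∃ φ : E → ℝ, LipschitzWith 1 φ ∧ (∀ x, |φ x| ≤ 1) ∧
    r = (∫ x, φ x ∂ν) - ∫ p, W u p.1 * φ p.2 ∂μ}

instance isProbabilityMeasure_unif01 : IsProbabilityMeasure unif01 :=
  ⟨by simp [unif01]⟩

lemma ae_mem_Icc_unif01 : ∀ᵐ v ∂unif01, v ∈ Icc (0 : ℝ) 1 :=
  ae_restrict_mem measurableSet_Icc

lemma Iseg_subset_Icc {n i : ℕ} (hi : i < n) : Iseg n i ⊆ Icc 0 1 := by
  have hn : (0 : ℝ) < n := by exact_mod_cast (Nat.zero_le i).trans_lt hi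
  have h1 : ((i : ℝ) + 1) / n ≤ 1 := by
    rw [div_le_one hn]; exact_mod_cast hi
  intro v hv
  unfold Iseg at hv
  split_ifs at hv with h
  · exact ⟨le_trans (by positivity) hv.1, hv.2⟩
  · exact ⟨le_trans (by positivity) hv.1, hv.2.le.trans h1⟩

lemma dist_le_of_mem_Iseg {n i : ℕ} (hi : i < n) {v w : ℝ} (hv : v ∈ Iseg n i)
    (hw : w ∈ Iseg n i) : dist v w ≤ 1 / n := by
  have hn : (0 : ℝ) < n := by exact_mod_cast (Nat.zero_le i).trans_lt hi
  have key : ∀ x ∈ Iseg n i, (i : ℝ) / n ≤ x ∧ x ≤ (i : ℝ) / n + 1 / n := by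
    intro x hx
    unfold Iseg at hx
    rw [← add_div]
    split_ifs at hx with h
    · refine ⟨hx.1, hx.2.trans ?_⟩
      have : (i : ℝ) + 1 = n := by exact_mod_cast h
      rw [this, div_self hn.ne']
    · exact ⟨hx.1, hx.2.le⟩
  have a := key v hv
  have b := key w hw
  rw [Real.dist_eq, abs_le]
  constructor <;> linarith [a.1, a.2, b.1, b.2]

lemma idx_lt {n : ℕ} (hn : 0 < n) (v : ℝ) : idx n v < n := by
  unfold idx; omega

lemma mem_Iseg_iff_idx_eq {n i : ℕ} (hi : i < n) {v : ℝ} (hv : v ∈ Icc (0 : ℝ) 1) :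
    v ∈ Iseg n i ↔ idx n v = i := by
  have hn : (0 : ℝ) < n := by exact_mod_cast (Nat.zero_le i).trans_lt hi
  have hnv : 0 ≤ (n : ℝ) * v := mul_nonneg hn.le hv.1
  unfold Iseg idx
  split_ifs with h
  · have : min (n - 1) ⌊(n : ℝ) * v⌋₊ = i ↔ i ≤ ⌊(n : ℝ) * v⌋₊ := by omega
    rw [this, Nat.le_floor_iff hnv, mem_Icc, div_le_iff₀ hn, mul_comm v]
    exact ⟨fun h => h.1, fun h => ⟨h, hv.2⟩⟩
  · have : min (n - 1) ⌊(n : ℝ) * v⌋₊ = i ↔ ⌊(n : ℝ) * v⌋₊ = i := by omega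
    rw [this, Nat.floor_eq_iff hnv, mem_Ico, div_le_iff₀ hn, lt_div_iff₀ hn, mul_comm v]

lemma measurable_idx (n : ℕ) : Measurable (idx n) := by
  unfold idx
  exact measurable_const.min (Nat.measurable_floor.comp (measurable_const.mul measurable_id))

lemma integrable_comp_idx {n : ℕ} (h : ℕ → ℝ) :
    Integrable (fun v => h (idx n v)) unif01 := by
  refine Integrable.of_bound ((measurable_of_countable h).comp
    (measurable_idx n)).aestronglyMeasurable (∑ i ∈ Finset.range (n + 1), |h i|) ?_
  refine Eventually.of_forall fun v => ?_
  rw [Real.norm_eq_abs]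
  refine Finset.single_le_sum (f := fun i => |h i|) (fun _ _ => abs_nonneg _) ?_
  rw [Finset.mem_range]; unfold idx; omega

lemma unif01_real_idx_preimage {n i : ℕ} (hi : i < n) :
    unif01.real (idx n ⁻¹' {i}) = 1 / n := by
  have hn : (0 : ℝ) < n := by exact_mod_cast (Nat.zero_le i).trans_lt hi
  have h1 : idx n ⁻¹' {i} ∩ Icc 0 1 = Iseg n i := by
    ext v
    constructor
    · rintro ⟨h, hv⟩
      exact (mem_Iseg_iff_idx_eq hi hv).2 h
    · intro h
      exact ⟨(mem_Iseg_iff_idx_eq hi (Iseg_subset_Icc hi h)).1 h, Iseg_subset_Icc hi h⟩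
  rw [Measure.real, unif01, Measure.restrict_apply (measurable_idx n (measurableSet_singleton i)),
    h1]
  unfold Iseg
  split_ifs with h
  · have : (i : ℝ) = n - 1 := by rw [eq_sub_iff_add_eq]; exact_mod_cast h
    rw [Real.volume_Icc, this, ENNReal.toReal_ofReal]
    · field_simp; ring
    · rw [sub_nonneg, div_le_one hn]; linarith
  · rw [Real.volume_Ico, ← sub_div, ENNReal.toReal_ofReal] <;> ring_nf
    positivity

/-- Averages over `{0, …, n - 1}` are integrals of step functions. -/
lemma integral_comp_idx {n : ℕ} (hn : 0 < n) (h : ℕ → ℝ) :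
    ∫ v, h (idx n v) ∂unif01 = (1 / n) * ∑ i ∈ Finset.range n, h i := by
  have h1 : ∀ v, h (idx n v)
      = ∑ i ∈ Finset.range n, (idx n ⁻¹' {i}).indicator (fun _ => h i) v := by
    intro v
    rw [Finset.sum_eq_single (idx n v)]
    · simp
    · intro b _ hb
      rw [indicator_of_notMem]
      simpa using hb.symm
    · intro hh
      exact absurd (Finset.mem_range.2 (idx_lt hn v)) hh
  simp_rw [h1]
  have hm : ∀ i, MeasurableSet (idx n ⁻¹' {i}) := fun i =>
    measurable_idx n (measurableSet_singleton i)
  rw [integral_finsetSum _ fun i _ => (integrable_const _).indicator (hm i), Finset.mul_sum]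
  refine Finset.sum_congr rfl fun i hi => ?_
  rw [integral_indicator_const _ (hm i), unif01_real_idx_preimage (Finset.mem_range.1 hi),
    smul_eq_mul]

/-- A function that integrates nonnegatively against nonnegative continuous functions is
nonnegative almost everywhere. -/
lemma ae_nonneg_of_forall_integral_mul_continuous_nonneg {m : Measure ℝ} [IsFiniteMeasure m]
    {h : ℝ → ℝ} (hm : Measurable h) (hi : Integrable h m)
    (H : ∀ g : BoundedContinuousFunction ℝ ℝ, (∀ v, 0 ≤ g v) → 0 ≤ ∫ v, h v * g v ∂m) :
    0 ≤ᵐ[m] h := by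
  refine ae_nonneg_of_forall_setIntegral_nonneg hi fun s hs _ => ?_
  refine le_of_forall_pos_le_add fun ε hε => ?_
  have hfin : IsFiniteMeasure (m.withDensity fun v => ENNReal.ofReal |h v|) :=
    isFiniteMeasure_withDensity_ofReal hi.abs.2
  have hind : Integrable (s.indicator fun _ => (1 : ℝ))
      (m.withDensity fun v => ENNReal.ofReal |h v|) := (integrable_const _).indicator hs
  obtain ⟨g, hg, -⟩ := hind.exists_boundedContinuous_integral_sub_le hε
  rw [integral_withDensity_eq_integral_toReal_smul
    hm.abs.ennreal_ofReal (Eventually.of_forall fun v => by simp)] at hg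
  have hgpos := H (g ⊔ 0) fun v => by simp
  have hint : ∀ f : ℝ → ℝ, Measurable f → (∃ C, ∀ v, |f v| ≤ C) →
      Integrable (fun v => h v * f v) m := fun f hf ⟨C, hC⟩ =>
    hi.mul_bdd hf.aestronglyMeasurable (Eventually.of_forall hC)
  have hgb : ∀ f : BoundedContinuousFunction ℝ ℝ, ∃ C, ∀ v, |f v| ≤ C := fun f =>
    ⟨‖f‖, fun v => f.norm_coe_le_norm v⟩
  have hsb : ∀ v, |s.indicator (fun _ => (1 : ℝ)) v| ≤ 1 := fun v => by
    by_cases hv : v ∈ s <;> simp [hv]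
  have hsm : Measurable (s.indicator fun _ => (1 : ℝ)) := measurable_const.indicator hs
  have e1 : ∫ v in s, h v ∂m = ∫ v, h v * s.indicator (fun _ => (1 : ℝ)) v ∂m := by
    rw [← integral_indicator hs]
    refine integral_congr_ae (Eventually.of_forall fun v => ?_)
    by_cases hv : v ∈ s <;> simp [hv]
  have hI : Integrable (fun v =>
      (ENNReal.ofReal |h v|).toReal • ‖s.indicator (fun _ => (1 : ℝ)) v - g v‖) m := by
    simp only [ENNReal.toReal_ofReal (abs_nonneg _), smul_eq_mul]
    obtain ⟨C, hC⟩ := hgb g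
    refine hi.abs.mul_bdd (c := 1 + C) (hsm.sub g.continuous.measurable).norm.aestronglyMeasurable
      (Eventually.of_forall fun v => ?_)
    rw [norm_norm]
    exact (norm_sub_le _ _).trans (add_le_add (hsb v) (hC v))
  have e2 : ∫ v, h v * (g ⊔ 0) v ∂m ≤ ∫ v, (h v * s.indicator (fun _ => (1 : ℝ)) v
      + (ENNReal.ofReal |h v|).toReal • ‖s.indicator (fun _ => (1 : ℝ)) v - g v‖) ∂m := by
    refine integral_mono (hint _ (g ⊔ 0).continuous.measurable (hgb _))
      ((hint _ hsm ⟨1, hsb⟩).add hI) fun v => ?_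
    simp only [ENNReal.toReal_ofReal (abs_nonneg _), smul_eq_mul, Real.norm_eq_abs]
    have h3 : |(g ⊔ 0) v - s.indicator (fun _ => (1 : ℝ)) v|
        ≤ |s.indicator (fun _ => (1 : ℝ)) v - g v| := by
      rw [abs_sub_comm _ (g v)]
      have : s.indicator (fun _ => (1 : ℝ)) v = max (s.indicator (fun _ => (1 : ℝ)) v) 0 := by
        by_cases hv : v ∈ s <;> simp [hv]
      conv_lhs => rw [this]
      exact abs_max_sub_max_le_abs _ _ _
    have h4 := (le_abs_self _).trans (abs_mul (h v)
      ((g ⊔ 0) v - s.indicator (fun _ => (1 : ℝ)) v)).le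
    have h5 := mul_le_mul_of_nonneg_left h3 (abs_nonneg (h v))
    rw [mul_sub] at h4
    linarith
  rw [integral_add (hint _ hsm ⟨1, hsb⟩) hI] at e2
  linarith

/-- For a weakly continuous nonnegative kernel, every slice is nonnegative. -/
lemma ae_nonneg_slice {W : ℝ → ℝ → ℝ}
    (hWmeas : Measurable fun p : ℝ × ℝ => W p.1 p.2)
    (hWnonneg : ∀ᵐ p ∂unif01.prod unif01, 0 ≤ W p.1 p.2)
    (hWslice : ∀ u ∈ Icc (0 : ℝ) 1, Integrable (W u) unif01)
    (hWcont : ∀ g : ℝ → ℝ, Continuous g →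
      ContinuousOn (fun u => ∫ v, W u v * g v ∂unif01) (Icc (0 : ℝ) 1))
    {u : ℝ} (hu : u ∈ Icc (0 : ℝ) 1) : ∀ᵐ v ∂unif01, 0 ≤ W u v := by
  refine ae_nonneg_of_forall_integral_mul_continuous_nonneg
    (hWmeas.comp measurable_prodMk_left) (hWslice u hu) fun g hg => ?_
  have hae : (fun s => ∫ v, W s v * g v ∂unif01)
      =ᵐ[volume.restrict (Icc (0 : ℝ) 1)] fun s => max (∫ v, W s v * g v ∂unif01) 0 := by
    filter_upwards [Measure.ae_ae_of_ae_prod hWnonneg] with s hs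
    refine (max_eq_left (integral_nonneg_of_ae ?_)).symm
    filter_upwards [hs] with v hv using mul_nonneg hv (hg v)
  have hc := hWcont g g.continuous
  have := Measure.eqOn_Icc_of_ae_eq volume zero_ne_one hae hc
    ((continuous_id.max continuous_const).comp_continuousOn hc) hu
  simp only at this
  rw [this]
  exact le_max_right _ _

lemma integral_Wstep_sub_mul {W : ℝ → ℝ → ℝ}
    (hWslice : ∀ u ∈ Icc (0 : ℝ) 1, Integrable (W u) unif01) (n : ℕ) (ζ : ℕ → ℕ → ℝ≥0)
    {F : ℝ → ℝ} (hF : Continuous F) {C : ℝ} (hC : ∀ v, |F v| ≤ C) {s : ℝ}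
    (hs : s ∈ Icc (0 : ℝ) 1) :
    ∫ v, (Wstep n ζ s v - W s v) * F v ∂unif01
      = ∫ v, (ζ (idx n s) (idx n v) : ℝ) * F v ∂unif01 - ∫ v, W s v * F v ∂unif01 := by
  rw [← integral_sub]
  · simp only [Wstep, sub_mul]
  · exact (integrable_comp_idx fun j => (ζ (idx n s) j : ℝ)).mul_bdd
      hF.aestronglyMeasurable (Eventually.of_forall hC)
  · exact (hWslice s hs).mul_bdd hF.aestronglyMeasurable (Eventually.of_forall hC)

lemma integrable_abs_integral_Wstep_sub_mul {W : ℝ → ℝ → ℝ}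
    (hWslice : ∀ u ∈ Icc (0 : ℝ) 1, Integrable (W u) unif01)
    (hWcont : ∀ g : ℝ → ℝ, Continuous g →
      ContinuousOn (fun u => ∫ v, W u v * g v ∂unif01) (Icc (0 : ℝ) 1))
    (n : ℕ) (ζ : ℕ → ℕ → ℝ≥0) {F : ℝ → ℝ} (hF : Continuous F) {C : ℝ} (hC : ∀ v, |F v| ≤ C) :
    Integrable (fun s => |∫ v, (Wstep n ζ s v - W s v) * F v ∂unif01|) unif01 := by
  refine Integrable.abs ?_
  refine Integrable.congr (f := fun s => ∫ v, (ζ (idx n s) (idx n v) : ℝ) * F v ∂unif01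
    - ∫ v, W s v * F v ∂unif01) ?_ ?_
  · refine (integrable_comp_idx fun i => ∫ v, (ζ i (idx n v) : ℝ) * F v ∂unif01).sub ?_
    exact (hWcont F hF).integrableOn_Icc
  · filter_upwards [ae_mem_Icc_unif01] with s hs
    exact (integral_Wstep_sub_mul hWslice n ζ hF hC hs).symm

/-- Riemann-sum version of strong operator convergence, uniform in the sampling points. -/
lemma exists_forall_average_abs_sub_lt {W : ℝ → ℝ → ℝ}
    (hWslice : ∀ u ∈ Icc (0 : ℝ) 1, Integrable (W u) unif01)
    (hWcont : ∀ g : ℝ → ℝ, Continuous g →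
      ContinuousOn (fun u => ∫ v, W u v * g v ∂unif01) (Icc (0 : ℝ) 1))
    (ξ : ℕ → ℕ → ℕ → ℝ≥0) (hconv : StrongOpTendsto (fun n => Wstep n (ξ n)) W)
    {F : ℝ → ℝ} (hF : Continuous F) {C : ℝ} (hC : ∀ v, |F v| ≤ C) {ε : ℝ} (hε : 0 < ε) :
    ∃ N : ℕ, ∀ n ≥ N, ∀ u : ℕ → ℝ, (∀ i < n, u i ∈ Iseg n i) →
      (1 / (n : ℝ)) * ∑ i ∈ Finset.range n,
        |(1 / (n : ℝ)) * ∑ j ∈ Finset.range n, (ξ n i j : ℝ) * F (u j)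
          - ∫ v, W (u i) v * F v ∂unif01| < ε := by
  obtain ⟨C₁, hC₁⟩ := isCompact_Icc.exists_bound_of_continuousOn (hWcont _ continuous_one)
  have hC₁0 : 0 ≤ C₁ := (norm_nonneg _).trans (hC₁ 0 (by simp))
  set ω := ε / (4 * (1 + C₁)) with hω
  have hω0 : 0 < ω := by positivity
  have hωC : ω * (1 + C₁) = ε / 4 := by rw [hω]; field_simp
  obtain ⟨d₁, hd₁, hFu⟩ := Metric.uniformContinuousOn_iff.1
    (isCompact_Icc.uniformContinuousOn_of_continuous (s := Icc (0 : ℝ) 1) hF.continuousOn) ω hω0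
  obtain ⟨d₂, hd₂, hGu⟩ := Metric.uniformContinuousOn_iff.1
    (isCompact_Icc.uniformContinuousOn_of_continuous (hWcont F hF)) (ε / 4) (by positivity)
  have t₁ := (hconv F hF.measurable ⟨C, hC⟩).eventually_lt_const
    (show (0 : ℝ) < ε / 4 by positivity)
  have t₂ := (hconv (fun _ => 1) measurable_const ⟨1, by simp⟩).eventually_lt_const one_pos
  have t₃ := tendsto_one_div_atTop_nhds_zero_nat.eventually_lt_const (lt_min hd₁ hd₂)
  obtain ⟨N, hN⟩ := eventually_atTop.1 (t₁.and (t₂.and (t₃.and (eventually_gt_atTop 0))))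
  refine ⟨N, fun n hn u hu => ?_⟩
  obtain ⟨h₁, h₂, h₃, hn0⟩ := hN n hn
  have hclose : ∀ s ∈ Icc (0 : ℝ) 1, u (idx n s) ∈ Icc (0 : ℝ) 1 ∧
      dist (u (idx n s)) s < min d₁ d₂ := fun s hs => by
    have hi := idx_lt hn0 s
    exact ⟨Iseg_subset_Icc hi (hu _ hi), (dist_le_of_mem_Iseg hi (hu _ hi)
      ((mem_Iseg_iff_idx_eq hi hs).2 rfl)).trans_lt h₃⟩
  rw [← integral_comp_idx hn0 fun i => |(1 / (n : ℝ)) * ∑ j ∈ Finset.range n,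
    (ξ n i j : ℝ) * F (u j) - ∫ v, W (u i) v * F v ∂unif01|]
  have i₁ := integrable_abs_integral_Wstep_sub_mul hWslice hWcont n (ξ n) hF hC
  have i₂ := integrable_abs_integral_Wstep_sub_mul hWslice hWcont n (ξ n)
    (continuous_const (y := (1 : ℝ))) (C := 1) (by simp)
  have hpt : ∀ s ∈ Icc (0 : ℝ) 1,
      |(1 / (n : ℝ)) * ∑ j ∈ Finset.range n, (ξ n (idx n s) j : ℝ) * F (u j)
          - ∫ v, W (u (idx n s)) v * F v ∂unif01|
        ≤ |∫ v, (Wstep n (ξ n) s v - W s v) * F v ∂unif01|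
          + (ω * (|∫ v, (Wstep n (ξ n) s v - W s v) * 1 ∂unif01| + C₁) + ε / 4) := by
    intro s hs
    have hG := hGu _ (hclose s hs).1 s hs ((hclose s hs).2.trans_le (min_le_right _ _))
    rw [Real.dist_eq] at hG
    rw [integral_Wstep_sub_mul hWslice n (ξ n) hF hC hs,
      integral_Wstep_sub_mul hWslice n (ξ n) (continuous_const (y := (1 : ℝ)))
        (C := 1) (by simp) hs,
      ← integral_comp_idx hn0 fun j => (ξ n (idx n s) j : ℝ) * F (u j)]
    have hstep := integrable_comp_idx (n := n) fun j => (ξ n (idx n s) j : ℝ)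
    have hB : |∫ v, (ξ n (idx n s) (idx n v) : ℝ) * F (u (idx n v)) ∂unif01
        - ∫ v, (ξ n (idx n s) (idx n v) : ℝ) * F v ∂unif01|
        ≤ ω * ∫ v, (ξ n (idx n s) (idx n v) : ℝ) * 1 ∂unif01 := by
      rw [← integral_sub (integrable_comp_idx fun j => (ξ n (idx n s) j : ℝ) * F (u j))
        (hstep.mul_bdd hF.aestronglyMeasurable (Eventually.of_forall hC)),
        ← integral_const_mul]
      rw [← Real.norm_eq_abs]
      refine norm_integral_le_of_norm_le ((hstep.mul_const 1).const_mul ω) ?_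
      filter_upwards [ae_mem_Icc_unif01] with v hv
      have := hFu _ (hclose v hv).1 v hv ((hclose v hv).2.trans_le (min_le_left _ _))
      rw [Real.dist_eq] at this
      rw [← mul_sub, norm_mul, Real.norm_eq_abs, Real.norm_eq_abs, NNReal.abs_eq, mul_one,
        mul_comm ω]
      exact mul_le_mul_of_nonneg_left this.le (NNReal.coe_nonneg _)
    have hH : |∫ v, W s v * 1 ∂unif01| ≤ C₁ := hC₁ s hs
    have hB' : ∫ v, (ξ n (idx n s) (idx n v) : ℝ) * 1 ∂unif01
        ≤ |∫ v, (ξ n (idx n s) (idx n v) : ℝ) * 1 ∂unif01 - ∫ v, W s v * 1 ∂unif01| + C₁ := by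
      linarith [le_abs_self (∫ v, (ξ n (idx n s) (idx n v) : ℝ) * 1 ∂unif01
        - ∫ v, W s v * 1 ∂unif01), le_abs_self (∫ v, W s v * 1 ∂unif01)]
    have hB'' := hB.trans (mul_le_mul_of_nonneg_left hB' hω0.le)
    rw [abs_sub_comm] at hG
    have := abs_sub_le (∫ v, (ξ n (idx n s) (idx n v) : ℝ) * F (u (idx n v)) ∂unif01)
      (∫ v, (ξ n (idx n s) (idx n v) : ℝ) * F v ∂unif01) (∫ v, W (u (idx n s)) v * F v ∂unif01)
    have := abs_sub_le (∫ v, (ξ n (idx n s) (idx n v) : ℝ) * F v ∂unif01)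
      (∫ v, W s v * F v ∂unif01) (∫ v, W (u (idx n s)) v * F v ∂unif01)
    linarith
  have i₃ := (i₂.add (integrable_const C₁)).const_mul ω
  have i₄ := i₃.add (integrable_const (ε / 4))
  refine (integral_mono_of_nonneg (Eventually.of_forall fun _ => abs_nonneg _) (i₁.add i₄)
    (ae_mem_Icc_unif01.mono hpt)).trans_lt ?_
  simp only [Pi.add_def] at i₃ i₄ ⊢
  rw [integral_add i₁ i₄, integral_add i₃ (integrable_const _), integral_const_mul,
    integral_add i₂ (integrable_const _)]
  simp only [integral_const, probReal_univ, one_smul]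
  have := mul_le_mul_of_nonneg_left (add_le_add_left h₂.le C₁) hω0.le
  linarith

lemma integral_abs_sum_sub_sum_integral_le {E : Type*} [MeasurableSpace E] {n : ℕ}
    (P : Fin n → Measure E) [∀ j, IsProbabilityMeasure (P j)] (a : Fin n → ℝ) {f : E → ℝ}
    (hf : Measurable f) {C : ℝ} (hC : ∀ x, |f x| ≤ C) {η : ℝ} (hη : 0 < η) :
    ∫ x, |∑ j, a j * f (x j) - ∑ j, a j * ∫ y, f y ∂P j| ∂Measure.pi P
      ≤ η + 1 / η * (C ^ 2 * ∑ j, a j ^ 2) := by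
  have hm : ∀ j, Measurable fun x : Fin n → E => a j * f (x j) := fun j =>
    (hf.comp (measurable_pi_apply j)).const_mul _
  have hb : ∀ j (x : Fin n → E), |a j * f (x j)| ≤ |a j| * C := fun j x => by
    rw [abs_mul]; exact mul_le_mul_of_nonneg_left (hC _) (abs_nonneg _)
  have hL : ∀ j, MemLp (fun x : Fin n → E => a j * f (x j)) 2 (Measure.pi P) := fun j =>
    MemLp.of_bound (hm j).aestronglyMeasurable _ (Eventually.of_forall (hb j))
  have hmean : ∫ x, (∑ j, fun x : Fin n → E => a j * f (x j)) x ∂Measure.pi P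
      = ∑ j, a j * ∫ y, f y ∂P j := by
    simp only [Finset.sum_apply]
    rw [integral_finsetSum _ fun j _ => (hL j).integrable (by norm_num)]
    refine Finset.sum_congr rfl fun j _ => ?_
    rw [integral_const_mul, integral_comp_eval hf.aestronglyMeasurable]
  have hvar : Var[∑ j, fun x : Fin n → E => a j * f (x j); Measure.pi P]
      ≤ C ^ 2 * ∑ j, a j ^ 2 := by
    rw [IndepFun.variance_sum (fun j _ => hL j), Finset.mul_sum]
    · refine Finset.sum_le_sum fun j _ =>
        (variance_le_expectation_sq (hm j).aestronglyMeasurable).trans ?_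
      have : ∀ x : Fin n → E, ((fun x : Fin n → E => a j * f (x j)) ^ 2) x ≤ C ^ 2 * a j ^ 2 := by
        intro x
        have := sq_le_sq' (neg_le_of_abs_le (hb j x)) (le_of_abs_le (hb j x))
        rw [mul_pow |a j|, sq_abs] at this
        simp only [Pi.pow_apply]
        linarith
      calc _ ≤ ∫ _ : Fin n → E, C ^ 2 * a j ^ 2 ∂Measure.pi P :=
            integral_mono_of_nonneg (Eventually.of_forall fun x => sq_nonneg _)
              (integrable_const _) (Eventually.of_forall this)
        _ = _ := by simp
    · intro i _ j _ hij
      exact (iIndepFun_pi (μ := P) (X := fun j y => a j * f y)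
        fun j => (hf.const_mul _).aemeasurable).indepFun hij
  have hLs : MemLp (∑ j, fun x : Fin n → E => a j * f (x j)) 2 (Measure.pi P) :=
    memLp_finsetSum' _ fun j _ => hL j
  rw [variance_eq_integral hLs.aestronglyMeasurable.aemeasurable, hmean] at hvar
  simp only [Finset.sum_apply] at hvar
  have hsq : Integrable (fun x : Fin n → E =>
      (∑ j, a j * f (x j) - ∑ j, a j * ∫ y, f y ∂P j) ^ 2) (Measure.pi P) := by
    have := (hLs.sub (memLp_const (∑ j, a j * ∫ y, f y ∂P j))).integrable_sq
    simpa only [Pi.sub_apply, Finset.sum_apply] using this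
  calc _ ≤ ∫ x, (η + 1 / η * (∑ j, a j * f (x j) - ∑ j, a j * ∫ y, f y ∂P j) ^ 2)
          ∂Measure.pi P := by
        refine integral_mono_of_nonneg (Eventually.of_forall fun x => abs_nonneg _)
          ((integrable_const _).add (hsq.const_mul _)) (Eventually.of_forall fun x => ?_)
        simp only
        rw [← sq_abs]
        generalize |∑ j, a j * f (x j) - ∑ j, a j * ∫ y, f y ∂P j| = y
        have : η + 1 / η * y ^ 2 - y = ((y - η / 2) ^ 2 + 3 / 4 * η ^ 2) / η := by
          field_simp; ring
        have : 0 ≤ η + 1 / η * y ^ 2 - y := by rw [this]; positivity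
        linarith
    _ ≤ _ := by
        rw [integral_add (integrable_const _) (hsq.const_mul _), integral_const_mul]
        simp only [integral_const, probReal_univ, one_smul]
        gcongr

lemma integrable_of_continuous_of_bound {X : Type*} [TopologicalSpace X]
    [SecondCountableTopology X]
    [MeasurableSpace X] [OpensMeasurableSpace X] {m : Measure X} [IsFiniteMeasure m] {f : X → ℝ}
    (hf : Continuous f) {C : ℝ} (hC : ∀ x, |f x| ≤ C) : Integrable f m :=
  Integrable.of_bound hf.aestronglyMeasurable C (Eventually.of_forall hC)

/-- Partition of unity subordinate to balls of radius `δ` around a dense sequence, together with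
the remainders of its partial sums. -/
lemma exists_partition_of_unity (E : Type*) [MetricSpace E] [TopologicalSpace.SeparableSpace E]
    [Nonempty E] {δ : ℝ} (hδ : 0 < δ) :
    ∃ (d : ℕ → E) (p r : ℕ → E → ℝ), (∀ k, Continuous (p k)) ∧ (∀ k, Continuous (r k)) ∧
      (∀ k x, 0 ≤ p k x) ∧ (∀ k x, 0 ≤ r k x) ∧
      (∀ K x, ∑ k ∈ Finset.range K, p k x + r K x = 1) ∧
      (∀ k x, p k x ≠ 0 → dist x (d k) ≤ δ) ∧ (∀ x, Antitone fun k => r k x) ∧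
      ∀ x, Tendsto (fun k => r k x) atTop (𝓝 0) := by
  set d := TopologicalSpace.denseSeq E
  set b : ℕ → E → ℝ := fun k x => max 0 (min 1 (2 - 2 / δ * dist x (d k))) with hb
  have hbc : ∀ k, Continuous (b k) := fun k => by fun_prop
  have hb0 : ∀ k x, 0 ≤ b k x := fun k x => le_max_left _ _
  have hb1 : ∀ k x, b k x ≤ 1 := fun k x => max_le zero_le_one (min_le_left _ _)
  set r : ℕ → E → ℝ := fun K x => ∏ k ∈ Finset.range K, (1 - b k x) with hr
  have hr0 : ∀ k x, 0 ≤ r k x := fun k x =>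
    Finset.prod_nonneg fun i _ => sub_nonneg.2 (hb1 i x)
  have hrs : ∀ k x, r (k + 1) x = r k x * (1 - b k x) := fun k x => Finset.prod_range_succ _ _
  have hanti : ∀ x, Antitone fun k => r k x := fun x => antitone_nat_of_succ_le fun k => by
    rw [hrs]; nlinarith [hr0 k x, hb0 k x]
  refine ⟨d, fun k x => r k x * b k x, r, fun k => ?_, fun k => ?_,
    fun k x => mul_nonneg (hr0 k x) (hb0 k x), hr0, fun K x => ?_, fun k x h => ?_, hanti,
    fun x => ?_⟩
  · exact (continuous_finsetProd _ fun i _ => continuous_const.sub (hbc i)).mul (hbc k)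
  · exact continuous_finsetProd _ fun i _ => continuous_const.sub (hbc i)
  · induction K with
    | zero => simp [hr]
    | succ K ih => rw [Finset.sum_range_succ, hrs]; linarith
  · by_contra! hlt
    refine h (mul_eq_zero_of_right _ (max_eq_left ((min_le_right _ _).trans ?_)))
    rw [sub_nonpos, div_mul_eq_mul_div, le_div_iff₀ hδ]
    linarith
  · obtain ⟨k, hk⟩ := (TopologicalSpace.denseRange_denseSeq E).exists_dist_lt x (half_pos hδ)
    have hbk : b k x = 1 := by
      have : 1 ≤ 2 - 2 / δ * dist x (d k) := by
        have : 2 / δ * dist x (d k) ≤ 1 := by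
          rw [div_mul_eq_mul_div, div_le_one hδ]
          linarith
        linarith
      simp [hb, min_eq_left this]
    refine tendsto_const_nhds.congr' ?_
    filter_upwards [eventually_gt_atTop k] with K hK
    refine le_antisymm (hr0 _ _) ((hanti x hK).trans ?_)
    simp [hrs, hbk]

/-- Bounded-Lipschitz functions are controlled by finitely many values, up to a remainder. -/
lemma abs_integral_sub_sum_le {E : Type*} [MetricSpace E] [SecondCountableTopology E]
    [MeasurableSpace E] [BorelSpace E] {m : Measure E} [IsFiniteMeasure m] {δ : ℝ}
    {d : ℕ → E} {p r : ℕ → E → ℝ}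
    (hpc : ∀ k, Continuous (p k)) (hrc : ∀ k, Continuous (r k)) (hp0 : ∀ k x, 0 ≤ p k x)
    (hr0 : ∀ k x, 0 ≤ r k x) (hsum : ∀ K x, ∑ k ∈ Finset.range K, p k x + r K x = 1)
    (hd : ∀ k x, p k x ≠ 0 → dist x (d k) ≤ δ) (hδ : 0 ≤ δ) (K : ℕ) {φ : E → ℝ}
    (hφ : LipschitzWith 1 φ) (hφ1 : ∀ x, |φ x| ≤ 1) :
    |∫ x, φ x ∂m - ∑ k ∈ Finset.range K, φ (d k) * ∫ x, p k x ∂m| ≤ ∫ x, (δ + r K x) ∂m := by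
  have hr1 : ∀ k x, r k x ≤ 1 := fun k x => by
    have := Finset.sum_nonneg fun i (_ : i ∈ Finset.range k) => hp0 i x
    linarith [hsum k x]
  have hp1 : ∀ k x, p k x ≤ 1 := fun k x => by
    have h1 := hsum (k + 1) x
    rw [Finset.sum_range_succ] at h1
    have := Finset.sum_nonneg fun i (_ : i ∈ Finset.range k) => hp0 i x
    linarith [hr0 (k + 1) x]
  have hpi : ∀ k, Integrable (p k) m := fun k => integrable_of_continuous_of_bound (hpc k)
    (C := 1) fun x => by rw [abs_of_nonneg (hp0 k x)]; exact hp1 k x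
  have hri : Integrable (r K) m := integrable_of_continuous_of_bound (hrc K)
    (C := 1) fun x => by rw [abs_of_nonneg (hr0 K x)]; exact hr1 K x
  simp_rw [← integral_const_mul]
  rw [← integral_finsetSum _ fun k _ => (hpi k).const_mul _,
    ← integral_sub (integrable_of_continuous_of_bound hφ.continuous hφ1)
      (integrable_finsetSum _ fun k _ => (hpi k).const_mul _), ← Real.norm_eq_abs]
  refine norm_integral_le_of_norm_le ((integrable_const δ).add hri)
    (Eventually.of_forall fun x => ?_)
  have e : φ x - ∑ k ∈ Finset.range K, φ (d k) * p k x
      = ∑ k ∈ Finset.range K, p k x * (φ x - φ (d k)) + r K x * φ x := by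
    calc _ = φ x * (∑ k ∈ Finset.range K, p k x + r K x)
          - ∑ k ∈ Finset.range K, φ (d k) * p k x := by rw [hsum, mul_one]
      _ = _ := by
        simp only [mul_sub, Finset.sum_sub_distrib, mul_add, Finset.mul_sum, mul_comm]
        ring
  rw [Real.norm_eq_abs, e]
  refine (abs_add_le _ _).trans (add_le_add ?_ ?_)
  · calc _ ≤ ∑ k ∈ Finset.range K, |p k x * (φ x - φ (d k))| := Finset.abs_sum_le_sum_abs _ _
      _ ≤ ∑ k ∈ Finset.range K, p k x * δ := by
        refine Finset.sum_le_sum fun k _ => ?_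
        rw [abs_mul, abs_of_nonneg (hp0 k x)]
        by_cases h : p k x = 0
        · simp [h]
        · refine mul_le_mul_of_nonneg_left ?_ (hp0 k x)
          have := hφ.dist_le_mul x (d k)
          rw [Real.dist_eq, NNReal.coe_one, one_mul] at this
          exact this.trans (hd k x h)
      _ ≤ δ := by
        rw [← Finset.sum_mul]
        have := hsum K x
        nlinarith [hr0 K x]
  · rw [abs_mul, abs_of_nonneg (hr0 K x)]
    exact mul_le_of_le_one_right (hr0 K x) (hφ1 x)

/-- The measure `Wμ(u)` on `E`. -/
def neighborhoodMeasure {E : Type*} [MeasurableSpace E] (W : ℝ → ℝ → ℝ) (μ : Measure (ℝ × E))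
    (u : ℝ) : Measure E :=
  (μ.withDensity fun p => ENNReal.ofReal (W u p.1)).map Prod.snd

section neighborhoodMeasure

variable {E : Type*} [MeasurableSpace E] {W : ℝ → ℝ → ℝ} {μ : Measure (ℝ × E)} {u : ℝ}

lemma integrable_comp_fst_of_map_fst (hμfst : μ.map Prod.fst = unif01) {h : ℝ → ℝ}
    (hi : Integrable h unif01) : Integrable (fun p => h p.1) μ := by
  rw [← hμfst] at hi
  exact hi.comp_measurable measurable_fst

lemma isFiniteMeasure_neighborhoodMeasure (hμfst : μ.map Prod.fst = unif01)
    (hi : Integrable (W u) unif01) : IsFiniteMeasure (neighborhoodMeasure W μ u) := by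
  have := isFiniteMeasure_withDensity_ofReal (integrable_comp_fst_of_map_fst hμfst hi).2
  unfold neighborhoodMeasure
  infer_instance

lemma integral_neighborhoodMeasure (hμfst : μ.map Prod.fst = unif01) (hm : Measurable (W u))
    (h0 : ∀ᵐ v ∂unif01, 0 ≤ W u v) {φ : E → ℝ} (hφ : Measurable φ) :
    ∫ x, φ x ∂neighborhoodMeasure W μ u = ∫ p, W u p.1 * φ p.2 ∂μ := by
  have hm' : Measurable fun p : ℝ × E => ENNReal.ofReal (W u p.1) :=
    (hm.comp measurable_fst).ennreal_ofReal
  rw [neighborhoodMeasure, integral_map measurable_snd.aemeasurable hφ.aestronglyMeasurable,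
    integral_withDensity_eq_integral_toReal_smul hm'
      (Eventually.of_forall fun p => ENNReal.ofReal_lt_top)]
  rw [← hμfst] at h0
  refine integral_congr_ae ?_
  filter_upwards [ae_of_ae_map measurable_fst.aemeasurable h0] with p hp
  rw [ENNReal.toReal_ofReal hp, smul_eq_mul]

lemma integral_mul_eq_of_disintegration [IsProbabilityMeasure μ]
    (hμfst : μ.map Prod.fst = unif01) {μd : ℝ → ProbabilityMeasure E}
    (hμdmeas : Measurable fun u => (μd u : Measure E))
    (hdisint : μ = unif01.bind fun u => (μd u : Measure E).map fun x => (u, x))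
    {h : ℝ → ℝ} (hi : Integrable h unif01) {f : E → ℝ} (hf : Measurable f) {C : ℝ}
    (hC : ∀ x, |f x| ≤ C) :
    ∫ p, h p.1 * f p.2 ∂μ = ∫ v, h v * ∫ x, f x ∂(μd v : Measure E) ∂unif01 := by
  let κ : Kernel ℝ E := ⟨fun u => (μd u : Measure E), hμdmeas⟩
  have hκ : IsMarkovKernel κ := ⟨fun u => inferInstanceAs (IsProbabilityMeasure (μd u : Measure E))⟩
  have hmap : ∀ (v : ℝ) {s : Set (ℝ × E)}, MeasurableSet s →
      ((μd v : Measure E).map fun x => (v, x)) s = κ v (Prod.mk v ⁻¹' s) := fun v s hs =>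
    Measure.map_apply measurable_prodMk_left hs
  have hmeas : Measurable fun v => (μd v : Measure E).map fun x => (v, x) := by
    refine Measure.measurable_of_measurable_coe _ fun s hs => ?_
    simp_rw [hmap _ hs]
    exact Kernel.measurable_kernel_prodMk_left hs
  have hμ : μ = unif01 ⊗ₘ κ := by
    ext s hs
    rw [hdisint, Measure.bind_apply hs hmeas.aemeasurable, Measure.compProd_apply hs]
    simp_rw [hmap _ hs]
  have hI : Integrable (fun p : ℝ × E => h p.1 * f p.2) μ :=
    (integrable_comp_fst_of_map_fst hμfst hi).mul_bdd
      (hf.comp measurable_snd).aestronglyMeasurable (Eventually.of_forall fun p => hC p.2)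
  rw [hμ] at hI ⊢
  rw [Measure.integral_compProd hI]
  simp only [integral_const_mul]
  rfl

end neighborhoodMeasure

section BoundedLipschitz

variable {E : Type*} [MetricSpace E] [MeasurableSpace E]

lemma blDiff_nonneg (ν : Measure E) (W : ℝ → ℝ → ℝ) (μ : Measure (ℝ × E)) (u : ℝ) :
    0 ≤ blDiff ν W μ u :=
  Real.sSup_nonneg' ⟨0, ⟨fun _ => 0, LipschitzWith.const' 0, by simp, by simp⟩, le_rfl⟩

lemma blDiff_le [SecondCountableTopology E] [BorelSpace E] {μ : Measure (ℝ × E)}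
    (hμfst : μ.map Prod.fst = unif01) {W : ℝ → ℝ → ℝ} {u : ℝ} (hm : Measurable (W u))
    (hi : Integrable (W u) unif01) (h0 : ∀ᵐ v ∂unif01, 0 ≤ W u v)
    (ν : Measure E) [IsFiniteMeasure ν] {δ : ℝ} {d : ℕ → E} {p r : ℕ → E → ℝ}
    (hpc : ∀ k, Continuous (p k)) (hrc : ∀ k, Continuous (r k)) (hp0 : ∀ k x, 0 ≤ p k x)
    (hr0 : ∀ k x, 0 ≤ r k x) (hsum : ∀ K x, ∑ k ∈ Finset.range K, p k x + r K x = 1)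
    (hd : ∀ k x, p k x ≠ 0 → dist x (d k) ≤ δ) (hδ : 0 ≤ δ) (K : ℕ) :
    blDiff ν W μ u ≤ ∑ k ∈ Finset.range K, |∫ x, p k x ∂ν - ∫ z, W u z.1 * p k z.2 ∂μ|
      + |∫ x, (δ + r K x) ∂ν - ∫ z, W u z.1 * (δ + r K z.2) ∂μ|
      + 2 * ∫ z, W u z.1 * (δ + r K z.2) ∂μ := by
  have := isFiniteMeasure_neighborhoodMeasure hμfst hi
  have hG : ∀ {φ : E → ℝ}, Continuous φ →
      ∫ z, W u z.1 * φ z.2 ∂μ = ∫ x, φ x ∂neighborhoodMeasure W μ u := fun hφ =>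
    (integral_neighborhoodMeasure hμfst hm h0 hφ.measurable).symm
  have hq : Continuous fun x => δ + r K x := continuous_const.add (hrc K)
  simp_rw [fun k => hG (hpc k)]
  rw [hG hq]
  have hqpos : 0 ≤ ∫ x, (δ + r K x) ∂neighborhoodMeasure W μ u :=
    integral_nonneg fun x => add_nonneg hδ (hr0 K x)
  refine Real.sSup_le ?_ (by positivity)
  rintro _ ⟨φ, hφ, hφ1, rfl⟩
  rw [hG hφ.continuous]
  have a₁ := le_of_abs_le
    (abs_integral_sub_sum_le (m := ν) hpc hrc hp0 hr0 hsum hd hδ K hφ hφ1)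
  have a₂ := neg_le_of_abs_le (abs_integral_sub_sum_le (m := neighborhoodMeasure W μ u)
    hpc hrc hp0 hr0 hsum hd hδ K hφ hφ1)
  have a₃ : ∑ k ∈ Finset.range K, φ (d k) * ∫ x, p k x ∂ν
      - ∑ k ∈ Finset.range K, φ (d k) * ∫ x, p k x ∂neighborhoodMeasure W μ u
      ≤ ∑ k ∈ Finset.range K, |∫ x, p k x ∂ν - ∫ x, p k x ∂neighborhoodMeasure W μ u| := by
    rw [← Finset.sum_sub_distrib]
    refine Finset.sum_le_sum fun k _ => ?_
    rw [← mul_sub]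
    refine (le_abs_self _).trans ?_
    rw [abs_mul]
    exact mul_le_of_le_one_left (abs_nonneg _) (hφ1 _)
  linarith [le_abs_self (∫ x, (δ + r K x) ∂ν - ∫ x, (δ + r K x) ∂neighborhoodMeasure W μ u)]

end BoundedLipschitz

/-- The weighted empirical measure `n⁻¹ ∑ⱼ aⱼ δ_{xⱼ}`. -/
abbrev weightedEmpirical {E : Type*} [MeasurableSpace E] {n : ℕ} (a : Fin n → ℝ≥0)
    (x : Fin n → E) : Measure E :=
  ((n : ℝ≥0∞))⁻¹ • (∑ j : Fin n, ((a j : ℝ≥0∞) • Measure.dirac (x j) : Measure E) : Measure E)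

section weightedEmpirical

variable {E : Type*} [MeasurableSpace E] {n : ℕ} (a : Fin n → ℝ≥0) (x : Fin n → E)

lemma isFiniteMeasure_weightedEmpirical (hn : 0 < n) :
    IsFiniteMeasure (weightedEmpirical a x) := by
  refine ⟨?_⟩
  simp only [Measure.smul_apply, Measure.finsetSum_apply, smul_eq_mul]
  refine ENNReal.mul_lt_top (by simp [hn]) ?_
  exact ENNReal.sum_lt_top.2 fun j _ => ENNReal.mul_lt_top (by simp) (measure_lt_top _ _)

lemma integral_weightedEmpirical [MeasurableSingletonClass E] (f : E → ℝ) :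
    ∫ y, f y ∂weightedEmpirical a x = (1 / (n : ℝ)) * ∑ j, (a j : ℝ) * f (x j) := by
  rw [integral_smul_measure, integral_finsetSum_measure]
  · simp [NNReal.smul_def]
  · intro j _
    exact (integrable_dirac (by simp)).smul_measure (by simp)

end weightedEmpirical

section Disintegration

variable {E : Type*} [MetricSpace E] [MeasurableSpace E] [BorelSpace E]
  {μd : ℝ → ProbabilityMeasure E}

lemma continuousOn_integral_of_continuousOn {s : Set ℝ} (hμdcont : ContinuousOn μd s)
    {f : E → ℝ} (hf : Continuous f) {C : ℝ} (hC : ∀ x, |f x| ≤ C) :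
    ContinuousOn (fun v => ∫ x, f x ∂(μd v : Measure E)) s := fun v hv =>
  ProbabilityMeasure.tendsto_iff_forall_integral_tendsto.1 (hμdcont v hv)
    (BoundedContinuousFunction.ofNormedAddCommGroup f hf C hC)

variable [SecondCountableTopology E]

/-- A continuous sequence decreasing to zero has uniformly small integrals along a weakly
continuous family of probability measures indexed by a compact set. -/
lemma exists_forall_integral_lt_of_antitone {s : Set ℝ} (hs : IsCompact s)
    (hμdcont : ContinuousOn μd s) {r : ℕ → E → ℝ} (hrc : ∀ k, Continuous (r k))
    (hr0 : ∀ k x, 0 ≤ r k x) (hr1 : ∀ k x, r k x ≤ 1) (hanti : ∀ x, Antitone fun k => r k x)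
    (hlim : ∀ x, Tendsto (fun k => r k x) atTop (𝓝 0)) {δ : ℝ} (hδ : 0 < δ) :
    ∃ K, ∀ v ∈ s, ∫ x, r K x ∂(μd v : Measure E) < δ := by
  have hb : ∀ k x, |r k x| ≤ 1 := fun k x => by rw [abs_of_nonneg (hr0 k x)]; exact hr1 k x
  have hdini := Antitone.tendstoUniformlyOn_of_forall_tendsto
    (F := fun k v => ∫ x, r k x ∂(μd v : Measure E)) (f := fun _ => 0) hs
    (fun k => continuousOn_integral_of_continuousOn hμdcont (hrc k) (hb k))
    (fun v _ i j hij => integral_mono (integrable_of_continuous_of_bound (hrc j) (hb j))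
      (integrable_of_continuous_of_bound (hrc i) (hb i)) fun x => hanti x hij)
    continuousOn_const fun v _ => by
      rw [← integral_zero E ℝ (μ := (μd v : Measure E))]
      exact tendsto_integral_of_dominated_convergence (fun _ => 1)
        (fun k => (hrc k).aestronglyMeasurable) (integrable_const _)
        (fun k => Eventually.of_forall (hb k)) (Eventually.of_forall hlim)
  obtain ⟨K, hK⟩ := (Metric.tendstoUniformlyOn_iff.1 hdini δ hδ).exists
  refine ⟨K, fun v hv => ?_⟩
  have := hK v hv
  rw [dist_comm, Real.dist_eq, sub_zero] at this
  exact (le_abs_self _).trans_lt this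

/-- Convergence of the empirical neighborhood measures tested against one bounded continuous
function. -/
lemma eventually_forall_average_integral_abs_lt
    {μ : Measure (ℝ × E)} [IsProbabilityMeasure μ] (hμfst : μ.map Prod.fst = unif01)
    {W : ℝ → ℝ → ℝ} (hWslice : ∀ u ∈ Icc (0 : ℝ) 1, Integrable (W u) unif01)
    (hWcont : ∀ g : ℝ → ℝ, Continuous g →
      ContinuousOn (fun u => ∫ v, W u v * g v ∂unif01) (Icc (0 : ℝ) 1))
    (hμdmeas : Measurable fun u => (μd u : Measure E))
    (hdisint : μ = unif01.bind fun u => (μd u : Measure E).map fun x => (u, x))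
    (hμdcont : ContinuousOn μd (Icc (0 : ℝ) 1))
    {ξ : ℕ → ℕ → ℕ → ℝ≥0} (hconv : StrongOpTendsto (fun n => Wstep n (ξ n)) W)
    (hξsq : Tendsto (fun n : ℕ => (1 / (n : ℝ) ^ 3) *
      ∑ i ∈ Finset.range n, ∑ j ∈ Finset.range n, (ξ n i j : ℝ) ^ 2) atTop (𝓝 0))
    {f : E → ℝ} (hf : Continuous f) {C : ℝ} (hC : ∀ x, |f x| ≤ C) {ε : ℝ} (hε : 0 < ε) :
    ∀ᶠ n : ℕ in atTop, ∀ u : Fin n → ℝ, (∀ i : Fin n, u i ∈ Iseg n i) →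
      (1 / (n : ℝ)) * ∑ i : Fin n, ∫ x : Fin n → E,
        |∫ y, f y ∂weightedEmpirical (fun j : Fin n => ξ n i j) x
          - ∫ p, W (u i) p.1 * f p.2 ∂μ| ∂(Measure.pi fun j : Fin n => (μd (u j) : Measure E))
        < ε := by
  set Φ : ℝ → ℝ := fun v => ∫ x, f x ∂(μd v : Measure E) with hΦ
  set F : ℝ → ℝ := fun v => Φ (projIcc 0 1 zero_le_one v) with hF
  have hFΦ : ∀ v ∈ Icc (0 : ℝ) 1, F v = Φ v := fun v hv => by
    simp only [hF, projIcc_of_mem zero_le_one hv]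
  have hFc : Continuous F :=
    (continuousOn_integral_of_continuousOn hμdcont hf hC).comp_continuous
      (continuous_subtype_val.comp continuous_projIcc) fun v => Subtype.property _
  have hFC : ∀ v, |F v| ≤ C := fun v => by
    have := norm_integral_le_of_norm_le_const (f := f) (C := C)
      (μ := (μd (projIcc 0 1 zero_le_one v) : Measure E)) (Eventually.of_forall hC)
    rwa [probReal_univ, mul_one] at this
  obtain ⟨N, hN⟩ := exists_forall_average_abs_sub_lt hWslice hWcont ξ hconv hFc hFC
    (show 0 < ε / 4 by positivity)
  have hsq := hξsq.const_mul (1 / (ε / 4) * C ^ 2)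
  rw [mul_zero] at hsq
  filter_upwards [eventually_ge_atTop N, eventually_gt_atTop 0,
    hsq.eventually_lt_const (show 0 < ε / 4 by positivity)] with n hn hn0 hsqn u hu
  have huI : ∀ i : Fin n, u i ∈ Icc (0 : ℝ) 1 := fun i => Iseg_subset_Icc i.2 (hu i)
  have hn0' : (0 : ℝ) < n := by exact_mod_cast hn0
  have hdet := hN n hn (fun k => if h : k < n then u ⟨k, h⟩ else 0) fun i hi => by
    simpa [hi] using hu ⟨i, hi⟩
  simp only [Finset.sum_range, Fin.is_lt, dite_true, Fin.eta] at hdet hsqn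
  set P : Fin n → Measure E := fun j => (μd (u j) : Measure E) with hP
  have hterm : ∀ i : Fin n, ∫ x : Fin n → E,
        |∫ y, f y ∂weightedEmpirical (fun j : Fin n => ξ n i j) x
          - ∫ p, W (u i) p.1 * f p.2 ∂μ| ∂Measure.pi P
      ≤ ε / 4 + 1 / (ε / 4) * (C ^ 2 * ∑ j : Fin n, ((ξ n i j : ℝ) / n) ^ 2)
        + |(1 / (n : ℝ)) * ∑ j : Fin n, (ξ n i j : ℝ) * F (u j)
          - ∫ v, W (u i) v * F v ∂unif01| := by
    intro i
    have hG : ∫ p, W (u i) p.1 * f p.2 ∂μ = ∫ v, W (u i) v * F v ∂unif01 := by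
      rw [integral_mul_eq_of_disintegration hμfst hμdmeas hdisint (hWslice _ (huI i))
        hf.measurable hC]
      refine integral_congr_ae ?_
      filter_upwards [ae_mem_Icc_unif01] with v hv
      rw [hFΦ v hv]
    have hmean : (1 / (n : ℝ)) * ∑ j : Fin n, (ξ n i j : ℝ) * F (u j)
        = ∑ j : Fin n, (ξ n i j : ℝ) / n * ∫ y, f y ∂P j := by
      rw [Finset.mul_sum]
      refine Finset.sum_congr rfl fun j _ => ?_
      rw [hFΦ _ (huI j)]
      ring
    have hemp : ∀ x : Fin n → E, ∫ y, f y ∂weightedEmpirical (fun j : Fin n => ξ n i j) x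
        = ∑ j : Fin n, (ξ n i j : ℝ) / n * f (x j) := by
      intro x
      rw [integral_weightedEmpirical, Finset.mul_sum]
      refine Finset.sum_congr rfl fun j _ => ?_
      ring
    simp_rw [hemp]
    rw [hG, hmean]
    have hvar := integral_abs_sum_sub_sum_integral_le P (fun j : Fin n => (ξ n i j : ℝ) / n)
      hf.measurable hC (show 0 < ε / 4 by positivity)
    have hint : Integrable (fun x : Fin n → E => |∑ j : Fin n, (ξ n i j : ℝ) / n * f (x j)
        - ∑ j : Fin n, (ξ n i j : ℝ) / n * ∫ y, f y ∂P j|) (Measure.pi P) := by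
      refine Integrable.abs (Integrable.sub ?_ (integrable_const _))
      refine integrable_finsetSum _ fun j _ => Integrable.const_mul ?_ _
      exact integrable_of_continuous_of_bound (hf.comp (continuous_apply j)) fun x => hC _
    calc _ ≤ ∫ x : Fin n → E, (|∑ j : Fin n, (ξ n i j : ℝ) / n * f (x j)
            - ∑ j : Fin n, (ξ n i j : ℝ) / n * ∫ y, f y ∂P j|
            + |∑ j : Fin n, (ξ n i j : ℝ) / n * ∫ y, f y ∂P j
              - ∫ v, W (u i) v * F v ∂unif01|) ∂Measure.pi P :=
          integral_mono_of_nonneg (Eventually.of_forall fun x => abs_nonneg _)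
            (hint.add (integrable_const _)) (Eventually.of_forall fun x => abs_sub_le _ _ _)
      _ ≤ _ := by
          rw [integral_add hint (integrable_const _)]
          simp only [integral_const, probReal_univ, one_smul]
          exact add_le_add_left hvar _
  have hsum := mul_le_mul_of_nonneg_left (Finset.sum_le_sum fun i (_ : i ∈ Finset.univ) => hterm i)
    (show 0 ≤ 1 / (n : ℝ) by positivity)
  refine hsum.trans_lt ?_
  rw [Finset.sum_add_distrib, Finset.sum_add_distrib, mul_add, mul_add]
  have e₁ : 1 / (n : ℝ) * ∑ _i : Fin n, ε / 4 = ε / 4 := by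
    simp only [Finset.sum_const, Finset.card_univ, Fintype.card_fin, nsmul_eq_mul]
    field_simp
  have e₂ : 1 / (n : ℝ) * ∑ i : Fin n,
        1 / (ε / 4) * (C ^ 2 * ∑ j : Fin n, ((ξ n i j : ℝ) / n) ^ 2)
      = 1 / (ε / 4) * C ^ 2 *
        (1 / (n : ℝ) ^ 3 * ∑ i : Fin n, ∑ j : Fin n, (ξ n i j : ℝ) ^ 2) := by
    simp only [Finset.mul_sum]
    refine Finset.sum_congr rfl fun i _ => Finset.sum_congr rfl fun j _ => ?_
    field_simp
  rw [e₁, e₂]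
  linarith

end Disintegration

/-- empirical neighborhood measures, continuous kernel, BL-norm version.
Under: strong operator convergence `W_{ξⁿ} → W`, `(1/n³) Σ (ξⁿᵢⱼ)² → 0`, weak continuity of
`u ↦ W(u,v)dv`, and weak continuity of the disintegration `u ↦ μ_u`, one has
`sup_{u ∈ Iⁿ₁×⋯×Iⁿₙ} (1/n) Σᵢ E‖Mⁿᵢ(u) − Wμ(uᵢ)‖_BL → 0`, where
`Mⁿᵢ(u) = (1/n) Σⱼ ξⁿᵢⱼ δ_{X_{uⱼ}}` and the `X_{uⱼ} ~ μ_{uⱼ}` are independent. -/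
theorem neighborhood_empirical_measure_convergence_continuous_BL
    {E : Type*} [MetricSpace E] [PolishSpace E] [MeasurableSpace E] [BorelSpace E]
    (μ : Measure (ℝ × E)) [IsProbabilityMeasure μ] (hμfst : μ.map Prod.fst = unif01)
    (W : ℝ → ℝ → ℝ)
    (hWmeas : Measurable fun p : ℝ × ℝ => W p.1 p.2)
    (hWint : Integrable (fun p : ℝ × ℝ => W p.1 p.2) (unif01.prod unif01))
    (hWnonneg : ∀ᵐ p ∂unif01.prod unif01, 0 ≤ W p.1 p.2)
    (hWslice : ∀ u ∈ Set.Icc (0:ℝ) 1, Integrable (W u) unif01)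
    (hWcont : ∀ g : ℝ → ℝ, Continuous g →
      ContinuousOn (fun u => ∫ v, W u v * g v ∂unif01) (Set.Icc (0:ℝ) 1))
    (μd : ℝ → ProbabilityMeasure E)
    (hμdmeas : Measurable fun u => (μd u : Measure E))
    (hdisint : μ = unif01.bind fun u => (μd u : Measure E).map fun x => (u, x))
    (hμdcont : ContinuousOn μd (Set.Icc (0:ℝ) 1))
    (ξ : ℕ → ℕ → ℕ → ℝ≥0) (hξdiag : ∀ n i, ξ n i i = 0)
    (hconv : StrongOpTendsto (fun n => Wstep n (ξ n)) W)
    (hξsq : Tendsto (fun n : ℕ => (1 / (n : ℝ) ^ 3) *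
      ∑ i ∈ Finset.range n, ∑ j ∈ Finset.range n, (ξ n i j : ℝ) ^ 2) atTop (𝓝 0)) :
    ∀ ε > (0:ℝ), ∃ N : ℕ, ∀ n ≥ N, ∀ u : Fin n → ℝ, (∀ i : Fin n, u i ∈ Iseg n i) →
      (1 / (n : ℝ)) * ∑ i : Fin n,
          ∫ x : Fin n → E,
            blDiff (((n : ℝ≥0∞))⁻¹ • (∑ j : Fin n,
                ((ξ n i j : ℝ≥0∞) • Measure.dirac (x j) : Measure E) : Measure E))
              W μ (u i)
            ∂(Measure.pi fun j : Fin n => (μd (u j) : Measure E))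
        < ε := by
  intro ε hε
  have : Nonempty E := (μd 0).nonempty
  obtain ⟨C₁, hC₁⟩ := isCompact_Icc.exists_bound_of_continuousOn (hWcont _ continuous_one)
  have hC₁0 : 0 ≤ C₁ := (norm_nonneg _).trans (hC₁ 0 (by simp))
  set δ := ε / (8 * (1 + C₁)) with hδdef
  have hδ : 0 < δ := by positivity
  have hδC : δ * (1 + C₁) = ε / 8 := by rw [hδdef]; field_simp
  obtain ⟨d, p, r, hpc, hrc, hp0, hr0, hsum, hd, hanti, hlim⟩ := exists_partition_of_unity E hδ
  have hr1 : ∀ k x, r k x ≤ 1 := fun k x => by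
    have := Finset.sum_nonneg fun i (_ : i ∈ Finset.range k) => hp0 i x
    linarith [hsum k x]
  have hp1 : ∀ k x, |p k x| ≤ 1 := fun k x => by
    have h1 := hsum (k + 1) x
    rw [Finset.sum_range_succ] at h1
    have := Finset.sum_nonneg fun i (_ : i ∈ Finset.range k) => hp0 i x
    rw [abs_of_nonneg (hp0 k x)]
    linarith [hr0 (k + 1) x]
  obtain ⟨K, hK⟩ := exists_forall_integral_lt_of_antitone isCompact_Icc hμdcont hrc hr0 hr1
    hanti hlim hδ
  have hrb : ∀ x, |r K x| ≤ 1 := fun x => by rw [abs_of_nonneg (hr0 K x)]; exact hr1 K x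
  have hqc : Continuous fun x => δ + r K x := continuous_const.add (hrc K)
  have hqb : ∀ x, |δ + r K x| ≤ δ + 1 := fun x => by
    rw [abs_of_nonneg (add_nonneg hδ.le (hr0 K x))]
    linarith [hr1 K x]
  have hη : 0 < ε / (2 * (K + 1)) := by positivity
  have hηK : (K + 1) * (ε / (2 * (K + 1))) = ε / 2 := by field_simp
  have evp := (Filter.eventually_all_finset (Finset.range K)).2 fun k _ =>
    eventually_forall_average_integral_abs_lt hμfst hWslice hWcont hμdmeas hdisint hμdcont
      hconv hξsq (hpc k) (hp1 k) hη
  have evq := eventually_forall_average_integral_abs_lt hμfst hWslice hWcont hμdmeas hdisint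
    hμdcont hconv hξsq hqc hqb hη
  obtain ⟨N, hN⟩ := eventually_atTop.1 (evp.and (evq.and (eventually_gt_atTop 0)))
  refine ⟨N, fun n hn u hu => ?_⟩
  obtain ⟨hp, hq, hn0⟩ := hN n hn
  replace hp := fun k hk => hp k hk u hu
  replace hq := hq u hu
  have hn0' : (0 : ℝ) < n := by exact_mod_cast hn0
  have huI : ∀ i : Fin n, u i ∈ Icc (0 : ℝ) 1 := fun i => Iseg_subset_Icc i.2 (hu i)
  set P : Measure (Fin n → E) := Measure.pi fun j : Fin n => (μd (u j) : Measure E)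
  set D : (E → ℝ) → Fin n → (Fin n → E) → ℝ := fun f i x =>
    |∫ y, f y ∂weightedEmpirical (fun j : Fin n => ξ n i j) x
      - ∫ z, W (u i) z.1 * f z.2 ∂μ| with hD
  have hDint : ∀ {f : E → ℝ} {C : ℝ}, Continuous f → (∀ x, |f x| ≤ C) → ∀ i,
      Integrable (D f i) P := by
    intro f C hf hC i
    simp only [hD, integral_weightedEmpirical]
    refine Integrable.abs (Integrable.sub (Integrable.const_mul ?_ _) (integrable_const _))
    refine integrable_finsetSum _ fun j _ => Integrable.const_mul ?_ _
    exact integrable_of_continuous_of_bound (hf.comp (continuous_apply j)) fun x => hC _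
  have hterm : ∀ i : Fin n, ∫ x, blDiff (weightedEmpirical (fun j : Fin n => ξ n i j) x)
        W μ (u i) ∂P
      ≤ ∑ k ∈ Finset.range K, ∫ x, D (p k) i x ∂P + ∫ x, D (fun y => δ + r K y) i x ∂P
        + 4 * δ * C₁ := by
    intro i
    have h0 := ae_nonneg_slice hWmeas hWnonneg hWslice hWcont (huI i)
    have hG : ∫ z, W (u i) z.1 * (δ + r K z.2) ∂μ ≤ 2 * δ * C₁ := by
      rw [integral_mul_eq_of_disintegration hμfst hμdmeas hdisint (hWslice _ (huI i))
        hqc.measurable hqb]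
      have hH : ∫ v, W (u i) v * 1 ∂unif01 ≤ C₁ := (le_abs_self _).trans (hC₁ _ (huI i))
      have hq0 : ∀ v, 0 ≤ ∫ x, (δ + r K x) ∂(μd v : Measure E) := fun v =>
        integral_nonneg fun x => add_nonneg hδ.le (hr0 K x)
      calc _ ≤ ∫ v, 2 * δ * (W (u i) v * 1) ∂unif01 := by
            refine integral_mono_of_nonneg ?_
              (((hWslice _ (huI i)).mul_const 1).const_mul _) ?_
            · filter_upwards [h0] with v hv using mul_nonneg hv (hq0 v)
            · filter_upwards [h0, ae_mem_Icc_unif01] with v hv hvI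
              have : ∫ x, (δ + r K x) ∂(μd v : Measure E) ≤ 2 * δ := by
                rw [integral_add (integrable_const _)
                  (integrable_of_continuous_of_bound (hrc K) hrb)]
                simp only [integral_const, probReal_univ, one_smul]
                linarith [hK v hvI]
              calc _ ≤ W (u i) v * (2 * δ) := mul_le_mul_of_nonneg_left this hv
                _ = _ := by ring
        _ ≤ _ := by
            rw [integral_const_mul]
            exact mul_le_mul_of_nonneg_left hH (by positivity)
    have hI₁ : Integrable (fun x => ∑ k ∈ Finset.range K, D (p k) i x) P :=
      integrable_finsetSum _ fun k _ => hDint (hpc k) (hp1 k) i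
    have hI₂ := hDint hqc hqb i
    have hI₃ : Integrable (fun x => ∑ k ∈ Finset.range K, D (p k) i x
      + D (fun y => δ + r K y) i x) P := hI₁.add hI₂
    calc _ ≤ ∫ x, (∑ k ∈ Finset.range K, D (p k) i x + D (fun y => δ + r K y) i x
            + 4 * δ * C₁) ∂P := by
          refine integral_mono_of_nonneg (Eventually.of_forall fun x => blDiff_nonneg _ _ _ _)
            (hI₃.add (integrable_const _)) (Eventually.of_forall fun x => ?_)
          have := isFiniteMeasure_weightedEmpirical (fun j : Fin n => ξ n i j) x hn0
          refine (blDiff_le hμfst (hWmeas.comp measurable_prodMk_left) (hWslice _ (huI i)) h0 _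
            hpc hrc hp0 hr0 hsum hd hδ.le K).trans ?_
          simp only [hD]
          linarith
      _ = _ := by
          rw [integral_add hI₃ (integrable_const _), integral_add hI₁ hI₂,
            integral_finsetSum _ fun k _ => hDint (hpc k) (hp1 k) i]
          simp only [integral_const, probReal_univ, one_smul]
  refine (mul_le_mul_of_nonneg_left (Finset.sum_le_sum fun i (_ : i ∈ Finset.univ) => hterm i)
    (show 0 ≤ 1 / (n : ℝ) by positivity)).trans_lt ?_
  rw [Finset.sum_add_distrib, Finset.sum_add_distrib, mul_add, mul_add, Finset.sum_comm,
    Finset.mul_sum]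
  have e₁ : 1 / (n : ℝ) * ∑ _i : Fin n, 4 * δ * C₁ = 4 * δ * C₁ := by
    simp only [Finset.sum_const, Finset.card_univ, Fintype.card_fin, nsmul_eq_mul]
    field_simp
  have e₂ : ∑ k ∈ Finset.range K, 1 / (n : ℝ) * ∑ i, ∫ x, D (p k) i x ∂P
      ≤ K * (ε / (2 * (K + 1))) := by
    refine (Finset.sum_le_sum fun k hk => (hp k hk).le).trans ?_
    simp
  rw [e₁]
  linarith

end
end
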